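/- arXiv:1407.1905 — 6 statements merged into one kernel-verified Lean document; each statement's English description precedes it below -/
import Mathlib

section
/- Let μ be a permutation of a finite set X and let m be a positive integer. Then the following are equivalent: (i) there exists a partition of X into m pairwise disjoint subsets X_0, X_1, ..., X_{m−1} such that μ(X_i) = X_{i+1} for i = 0, 1, ..., m−1 (subscripts taken modulo m); (ii) the cardinality of every μ-orbit on X is divisible by m. -/
/-- All `μ`-orbits have size divisible by `m` iff there is a `ZMod m`-valued function which `μ`
increases by one. -/
theorem Equiv.Perm.exists_map_apply_eq_add_one_iff {X : Type*} [Finite X]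
    (μ : Equiv.Perm X) (m : ℕ) :
    (∃ f : X → ZMod m, ∀ x, f (μ x) = f x + 1) ↔
      ∀ x : X, m ∣ Nat.card (MulAction.orbit (Subgroup.zpowers μ) x) := by
  have card_orbit (x : X) : Nat.card (MulAction.orbit (Subgroup.zpowers μ) x) =
      Function.minimalPeriod (μ • ·) x := by
    have := Fintype.ofFinite (MulAction.orbit (Subgroup.zpowers μ) x)
    rw [Nat.card_eq_fintype_card, MulAction.minimalPeriod_eq_card]
  constructor
  · rintro ⟨f, hf⟩ x
    have map_iterate (k : ℕ) : f (μ^[k] x) = f x + k := by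
      induction k with
      | zero => simp
      | succ k ih => rw [Function.iterate_succ_apply', hf, ih]; push_cast; ring
    have h := map_iterate (Function.minimalPeriod μ x)
    rw [Function.iterate_minimalPeriod, left_eq_add, ZMod.natCast_eq_zero_iff] at h
    rw [card_orbit]
    exact h
  · intro h
    let r (x : X) : X := (Quotient.mk (Equiv.Perm.SameCycle.setoid μ) x).out
    have hr (x : X) : μ.SameCycle (r x) x :=
      Quotient.exact (Quotient.out_eq (Quotient.mk (Equiv.Perm.SameCycle.setoid μ) x))
    have r_apply (x : X) : r (μ x) = r x :=
      congrArg Quotient.out (Quotient.sound (Equiv.Perm.sameCycle_apply_left.2 (.refl μ x)))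
    choose k hk using hr
    refine ⟨fun x ↦ (k x : ZMod m), fun x ↦ ?_⟩
    have fixed : μ ^ (k (μ x) - (k x + 1)) • r x = r x := by
      rw [sub_eq_neg_add, zpow_add, mul_smul, zpow_neg, inv_smul_eq_iff, add_comm (k x) 1,
        zpow_add, mul_smul, zpow_one]
      simp only [Equiv.Perm.smul_def]
      rw [hk x, ← r_apply x, hk (μ x)]
    rw [MulAction.zpow_smul_eq_iff_minimalPeriod_dvd, ← card_orbit] at fixed
    have hdvd := (Int.natCast_dvd_natCast.2 (h (r x))).trans fixed
    rw [← ZMod.intCast_zmod_eq_zero_iff_dvd] at hdvd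
    push_cast at hdvd
    exact sub_eq_zero.1 hdvd

/-- Let `μ` be a permutation of a finite set `X` and `m` a positive
integer. There is a partition of `X` into `m` pairwise disjoint subsets
`X_0, …, X_{m-1}` (indexed cyclically by `ZMod m`) with `μ(X_i) = X_{i+1}`
(subscripts mod `m`) iff the cardinality of every `μ`-orbit on `X` is divisible
by `m`. -/
theorem orbit_partition_iff_card_orbits_div {X : Type*} [Fintype X]
    (μ : Equiv.Perm X) (m : ℕ) (hm : 0 < m) :
    (∃ P : ZMod m → Set X,
        Pairwise (Function.onFun Disjoint P) ∧
        (⋃ i, P i) = Set.univ ∧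
        (∀ i : ZMod m, (⇑μ) '' P i = P (i + 1))) ↔
      (∀ x : X, m ∣ Nat.card (MulAction.orbit (Subgroup.zpowers μ) x)) := by
  rw [← Equiv.Perm.exists_map_apply_eq_add_one_iff]
  constructor
  · rintro ⟨P, disj, cover, image⟩
    have mem (x : X) : ∃ i, x ∈ P i := Set.mem_iUnion.1 (cover ▸ Set.mem_univ x)
    choose f hf using mem
    refine ⟨f, fun x ↦ ?_⟩
    by_contra hne
    exact Set.disjoint_left.1 (disj hne) (hf (μ x)) (image (f x) ▸ Set.mem_image_of_mem μ (hf x))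
  · rintro ⟨f, hf⟩
    refine ⟨fun i ↦ f ⁻¹' {i}, ?_, ?_, fun i ↦ ?_⟩
    · exact fun i j hij ↦ (Set.disjoint_singleton.2 hij).preimage f
    · ext x
      simp
    · ext x
      obtain ⟨y, rfl⟩ := μ.surjective x
      simp [hf]
end

section
/- Let a ≥ 2 be an integer and let u be an odd integer with u ≠ −1 and ν₂(u−1) = 1. Then in the unit group (Z/2^a Z)^*: (1) ⟨ū⟩ ∩ ⟨5̄⟩ = ⟨ū²⟩; (2) the order of ū² equals 2^{max{a − ν₂(u+1) − 1, 0}}; and (3) the quotient group (Z/2^a Z)^*/⟨ū⟩ is a cyclic group of order 2^{min{ν₂(u+1)−1, a−2}}. -/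
/-- The residue class of `5` as a unit of `ZMod (2^a)`. -/
def fiveUnit (a : ℕ) : (ZMod (2 ^ a))ˣ :=
  ZMod.unitOfCoprime 5 (Nat.Coprime.pow_right a (by norm_num))

/-- For `a ≥ 2`, reduction of units modulo `2 ^ a` to units modulo `4`. -/
def unitsModFour (a : ℕ) (ha : 2 ≤ a) : (ZMod (2 ^ a))ˣ →* (ZMod 4)ˣ :=
  ZMod.unitsMap (pow_dvd_pow 2 ha : 2 ^ 2 ∣ 2 ^ a)

lemma unitsModFour_surjective (a : ℕ) (ha : 2 ≤ a) :
    Function.Surjective (unitsModFour a ha) :=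
  ZMod.unitsMap_surjective (pow_dvd_pow 2 ha : 2 ^ 2 ∣ 2 ^ a)

lemma coe_unitsModFour_of_coe_eq {a : ℕ} (ha : 2 ≤ a) {x : (ZMod (2 ^ a))ˣ} {u : ℤ}
    (hx : (x : ZMod (2 ^ a)) = u) : (unitsModFour a ha x : ZMod 4) = u := by
  change ZMod.castHom (pow_dvd_pow 2 ha : 2 ^ 2 ∣ 2 ^ a) (ZMod (2 ^ 2)) (x : ZMod (2 ^ a)) = u
  rw [hx, map_intCast]

lemma natCard_units_zmod_two_pow (a : ℕ) (ha : 2 ≤ a) :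
    Nat.card (ZMod (2 ^ a))ˣ = 2 ^ (a - 1) := by
  rw [Nat.card_eq_fintype_card, ZMod.card_units_eq_totient,
    Nat.totient_prime_pow Nat.prime_two (by lia)]
  simp

lemma orderOf_fiveUnit (a : ℕ) (ha : 2 ≤ a) : orderOf (fiveUnit a) = 2 ^ (a - 2) := by
  obtain ⟨n, rfl⟩ := Nat.exists_eq_add_of_le' ha
  rw [← orderOf_units, Nat.add_sub_cancel, ← ZMod.orderOf_five n]
  simp [fiveUnit]

/-- The units modulo `2 ^ a` that are `1` modulo `4` are the powers of `5`. -/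
lemma zpowers_fiveUnit_eq_ker (a : ℕ) (ha : 2 ≤ a) :
    Subgroup.zpowers (fiveUnit a) = (unitsModFour a ha).ker := by
  apply Subgroup.eq_of_le_of_card_ge
  · rw [Subgroup.zpowers_le, MonoidHom.mem_ker]
    ext
    rw [coe_unitsModFour_of_coe_eq ha (u := 5) (by simp [fiveUnit])]
    rfl
  · have hcard : Nat.card (unitsModFour a ha).range = 2 := by
      rw [MonoidHom.range_eq_top.mpr (unitsModFour_surjective a ha), Subgroup.card_top,
        Nat.card_eq_fintype_card, ZMod.card_units_eq_totient]
      rfl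
    have hmul := (unitsModFour a ha).ker.card_mul_index
    rw [Subgroup.index_ker, hcard, natCard_units_zmod_two_pow a ha,
      show a - 1 = a - 2 + 1 by lia, pow_succ] at hmul
    rw [Nat.card_zpowers, orderOf_fiveUnit a ha]
    lia

lemma units_zmod_four_eq_one_or_of_ne_one {c : (ZMod 4)ˣ} (hc : c ≠ 1) (x : (ZMod 4)ˣ) :
    x = 1 ∨ x = c := by
  decide +revert

/-- For a unit `x` that is `3` modulo `4`, exactly the even powers of `x` are powers of `5`. -/
lemma zpow_mem_zpowers_fiveUnit_iff {a : ℕ} (ha : 2 ≤ a) {x : (ZMod (2 ^ a))ˣ}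
    (hx : orderOf (unitsModFour a ha x) = 2) (k : ℤ) :
    x ^ k ∈ Subgroup.zpowers (fiveUnit a) ↔ Even k := by
  rw [zpowers_fiveUnit_eq_ker a ha, MonoidHom.mem_ker, map_zpow,
    ← orderOf_dvd_iff_zpow_eq_one, hx, even_iff_two_dvd]
  rfl

lemma zpowers_inf_zpowers_fiveUnit {a : ℕ} (ha : 2 ≤ a) {x : (ZMod (2 ^ a))ˣ}
    (hx : orderOf (unitsModFour a ha x) = 2) :
    Subgroup.zpowers x ⊓ Subgroup.zpowers (fiveUnit a) = Subgroup.zpowers (x ^ 2) := by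
  apply le_antisymm
  · rintro _ ⟨⟨k, rfl⟩, hk⟩
    obtain ⟨m, rfl⟩ := (zpow_mem_zpowers_fiveUnit_iff ha hx k).mp hk
    refine ⟨m, ?_⟩
    change (x ^ 2) ^ m = x ^ (m + m)
    rw [← two_mul, zpow_mul, zpow_ofNat]
  · rw [Subgroup.zpowers_le]
    refine ⟨pow_mem (Subgroup.mem_zpowers x) 2, ?_⟩
    simpa using (zpow_mem_zpowers_fiveUnit_iff ha hx 2).mpr even_two

lemma isCyclic_units_zmod_two_pow_quotient_zpowers {a : ℕ} (ha : 2 ≤ a) {x : (ZMod (2 ^ a))ˣ}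
    (hx : orderOf (unitsModFour a ha x) = 2) :
    IsCyclic ((ZMod (2 ^ a))ˣ ⧸ Subgroup.zpowers x) := by
  have hne : unitsModFour a ha x ≠ 1 := fun h ↦ by simp [h] at hx
  apply isCyclic_of_surjective
    ((QuotientGroup.mk' (Subgroup.zpowers x)).comp (Subgroup.zpowers (fiveUnit a)).subtype)
  intro q
  obtain ⟨y, rfl⟩ := QuotientGroup.mk'_surjective _ q
  rcases units_zmod_four_eq_one_or_of_ne_one hne (unitsModFour a ha y) with h | h
  · exact ⟨⟨y, by rwa [zpowers_fiveUnit_eq_ker a ha, MonoidHom.mem_ker]⟩, rfl⟩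
  · refine ⟨⟨y * x⁻¹, ?_⟩, ?_⟩
    · rw [zpowers_fiveUnit_eq_ker a ha, MonoidHom.mem_ker, map_mul, map_inv, h, mul_inv_cancel]
    · exact QuotientGroup.eq.mpr (by simp)

/-- The order modulo `2 ^ a` of the square of `2 ^ v * w - 1`, where `w` is odd and `v ≥ 2`. -/
lemma orderOf_sq_two_pow_mul_sub_one (a v : ℕ) (hv : 2 ≤ v) (w : ℤ) (hw : Odd w) :
    orderOf (((2 ^ v * w - 1 : ℤ) : ZMod (2 ^ a)) ^ 2) = 2 ^ (a - v - 1) := by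
  obtain ⟨n, rfl⟩ := Nat.exists_eq_add_of_le' hv
  have hsq : (2 ^ (n + 2) * w - 1) ^ 2 = 1 + 2 ^ (n + 3) * (w * (2 * (2 ^ n * w) - 1)) := by ring
  rw [← Int.cast_pow, hsq]
  have hodd : Odd (w * (2 * (2 ^ n * w) - 1)) := hw.mul (by simp [parity_simps])
  generalize w * (2 * (2 ^ n * w) - 1) = c at hodd
  rcases le_total (n + 3) a with h | h
  · obtain ⟨k, rfl⟩ := Nat.exists_eq_add_of_le' h
    have := ZMod.orderOf_one_add_mul_prime_pow Nat.prime_two (n + 3) (by lia) (by lia) c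
      (by rwa [← Int.not_even_iff_odd, even_iff_two_dvd] at hodd) k
    rw [show k + (n + 3) - (n + 2) - 1 = k by lia, ← this]
    simp
  · rw [show a - (n + 2) - 1 = 0 by lia, pow_zero, orderOf_eq_one_iff, Int.cast_add, Int.cast_one,
      add_eq_left, ZMod.intCast_zmod_eq_zero_iff_dvd]
    exact_mod_cast (pow_dvd_pow (2 : ℤ) h).mul_right c

/-- Let `a ≥ 2` and let `u ≠ -1` be an odd integer with
`ν₂(u-1) = 1`.  Let `ubar` be the residue of `u` in `(ZMod (2^a))ˣ`.  Then:
(1) `⟨ubar⟩ ⊓ ⟨5̄⟩ = ⟨ubar²⟩`; (2) `orderOf (ubar²) = 2 ^ max (a - ν₂(u+1) - 1) 0`;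
and (3) the quotient `(ZMod (2^a))ˣ / ⟨ubar⟩` is cyclic of order
`2 ^ min (ν₂(u+1) - 1) (a - 2)`. -/
theorem units_zmod_two_pow_quotient_cyclic (a : ℕ) (ha : 2 ≤ a) (u : ℤ)
    (hu : Odd u) (hune : u ≠ -1) (hval : padicValInt 2 (u - 1) = 1)
    (ubar : (ZMod (2 ^ a))ˣ) (hubar : (ubar : ZMod (2 ^ a)) = (u : ZMod (2 ^ a))) :
    Subgroup.zpowers ubar ⊓ Subgroup.zpowers (fiveUnit a) =
      Subgroup.zpowers (ubar ^ 2) ∧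
    orderOf (ubar ^ 2) = 2 ^ max (a - padicValInt 2 (u + 1) - 1) 0 ∧
    (IsCyclic ((ZMod (2 ^ a))ˣ ⧸ Subgroup.zpowers ubar) ∧
     Nat.card ((ZMod (2 ^ a))ˣ ⧸ Subgroup.zpowers ubar) =
       2 ^ min (padicValInt 2 (u + 1) - 1) (a - 2)) := by
  have hfour : ¬ (4 : ℤ) ∣ u - 1 := fun h ↦ by
    have := (padicValInt_dvd_iff (p := 2) 2 (u - 1)).mp (by simpa using h)
    rcases this with h0 | h2
    · simp [h0] at hval
    · lia
  obtain ⟨t, rfl⟩ : ∃ t, u = 4 * t + 3 := ⟨u / 4, by obtain ⟨s, rfl⟩ := hu; lia⟩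
  have hred : unitsModFour a ha ubar = -1 := by
    ext
    rw [coe_unitsModFour_of_coe_eq ha hubar]
    push_cast
    rw [show (4 : ZMod 4) = 0 from rfl, zero_mul, zero_add]
    rfl
  have hord : orderOf (unitsModFour a ha ubar) = 2 := by
    rw [hred]
    exact orderOf_eq_prime (by simp) (by decide)
  have hne : 4 * t + 3 + 1 ≠ 0 := by lia
  have hv : 2 ≤ padicValInt 2 (4 * t + 3 + 1) :=
    ((padicValInt_dvd_iff (p := 2) 2 _).mp ⟨t + 1, by push_cast; ring⟩).resolve_left hne
  obtain ⟨w, hw⟩ := padicValInt_dvd (p := 2) (4 * t + 3 + 1)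
  have hwodd : Odd w := by
    rw [← Int.not_even_iff_odd, even_iff_two_dvd]
    rintro ⟨s, rfl⟩
    have := ((padicValInt_dvd_iff (p := 2) (padicValInt 2 (4 * t + 3 + 1) + 1) _).mp
      ⟨s, by rw [pow_succ, mul_assoc]; exact hw⟩).resolve_left hne
    lia
  generalize padicValInt 2 (4 * t + 3 + 1) = v at hv hw
  have hsq : orderOf (ubar ^ 2) = 2 ^ (a - v - 1) := by
    rw [← orderOf_units, Units.val_pow_eq_pow_val, hubar,
      ← orderOf_sq_two_pow_mul_sub_one a v hv w hwodd,
      show 4 * t + 3 = 2 ^ v * w - 1 by push_cast at hw; lia]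
  refine ⟨zpowers_inf_zpowers_fiveUnit ha hord, by simpa using hsq,
    isCyclic_units_zmod_two_pow_quotient_zpowers ha hord, ?_⟩
  have heven : 2 ∣ orderOf ubar := by
    simpa [hord] using orderOf_map_dvd (unitsModFour a ha) ubar
  rw [orderOf_pow_of_dvd two_ne_zero heven] at hsq
  have hmul := (Subgroup.zpowers ubar).card_eq_card_quotient_mul_card_subgroup
  rw [natCard_units_zmod_two_pow a ha, Nat.card_zpowers,
    show orderOf ubar = 2 ^ (a - v - 1 + 1) by rw [pow_succ]; lia,
    show a - 1 = min (v - 1) (a - 2) + (a - v - 1 + 1) by lia, pow_add] at hmul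
  exact (Nat.eq_of_mul_eq_mul_right (by positivity) hmul).symm
end

section
/- Let a ≥ 2 be an integer and let h, u be odd integers with u ≠ −1, ν₂(u−1) = 1 and ν₂(h−1) ≥ 2. Let h̄ denote the image of h in the quotient group (Z/2^a Z)^*/⟨ū⟩. Then the order of h̄ equals 2^v, where v = max{ min{ν₂(u+1)+1, a} − ν₂(h−1), 0 }. -/
theorem Int.exists_odd_pow_two_pow_eq {w c : ℤ} {t : ℕ} (ht : 2 ≤ t) (hc : Odd c)
    (hw : w = 1 + 2 ^ t * c) (j : ℕ) :
    ∃ d : ℤ, Odd d ∧ w ^ 2 ^ j = 1 + 2 ^ (t + j) * d := by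
  induction j with
  | zero => exact ⟨c, hc, by simpa using hw⟩
  | succ j ih =>
    obtain ⟨d, hd, h⟩ := ih
    obtain ⟨i, hi⟩ : ∃ i, t + j = i + 1 := ⟨t + j - 1, by omega⟩
    have hi0 : i ≠ 0 := by omega
    have he : Even ((2 : ℤ) ^ i * d ^ 2) :=
      ((even_two (α := ℤ)).pow_of_ne_zero hi0).mul_right _
    refine ⟨d + 2 ^ i * d ^ 2, hd.add_even he, ?_⟩
    rw [pow_succ 2 j, pow_mul, h, ← add_assoc, hi]
    ring

/-- Powers of an integer `w` with `ν₂(w - 1) = t ≥ 2` approximate 2-adically every integer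
congruent to `1` modulo `2 ^ t`. -/
theorem Int.exists_two_pow_dvd_sub_pow {w c x : ℤ} {t : ℕ} (ht : 2 ≤ t) (hc : Odd c)
    (hw : w = 1 + 2 ^ t * c) (hx : (2 : ℤ) ^ t ∣ x - 1) (j : ℕ) :
    ∃ k : ℕ, (2 : ℤ) ^ (t + j) ∣ x - w ^ k := by
  induction j with
  | zero => exact ⟨0, by simpa using hx⟩
  | succ j ih =>
    obtain ⟨k, q, hq⟩ := ih
    rcases Int.even_or_odd q with ⟨p, hp⟩ | hodd
    · exact ⟨k, p, by rw [hq, hp]; ring⟩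
    · obtain ⟨d, hd, h⟩ := Int.exists_odd_pow_two_pow_eq ht hc hw j
      have hwo : Odd w := by
        rw [hw]
        exact odd_one.add_even
          (((even_two (α := ℤ)).pow_of_ne_zero (by omega)).mul_right _)
      obtain ⟨p, hp⟩ := hodd.sub_odd ((hwo.pow (n := k)).mul hd)
      refine ⟨k + 2 ^ j, p, ?_⟩
      rw [pow_add, h]
      linear_combination hq + 2 ^ (t + j) * hp

theorem Int.two_pow_dvd_pow_sub_one_iff {h : ℤ} (hne : h ≠ 1) (h4 : 4 ∣ h - 1) (m n : ℕ) :
    (2 : ℤ) ^ m ∣ h ^ n - 1 ↔ 2 ^ (m - padicValInt 2 (h - 1)) ∣ n := by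
  have key := Int.two_pow_sub_pow' (x := h) (y := 1) n h4 (by omega)
  have hv : emultiplicity 2 (h - 1) = padicValInt 2 (h - 1) := by
    rw [padicValInt.of_ne_one_ne_zero (by norm_num) (sub_ne_zero.mpr hne)]
    exact (Int.finiteMultiplicity_iff.mpr
      ⟨by norm_num, sub_ne_zero.mpr hne⟩).emultiplicity_eq_multiplicity
  have hn : emultiplicity (2 : ℤ) (n : ℤ) = emultiplicity 2 n := by
    exact_mod_cast Int.natCast_emultiplicity 2 n
  rw [one_pow] at key
  rw [pow_dvd_iff_le_emultiplicity, pow_dvd_iff_le_emultiplicity, key, hv, hn, ENat.natCast_sub,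
    tsub_le_iff_left]

/-- The subgroup generated by `u ≡ -1 [ZMOD 4]` meets the residues of integers `x ≡ 1 [ZMOD 4]`
in those congruent to `1` modulo `2 ^ (ν₂(u + 1) + 1)`. -/
theorem ZMod.mem_zpowers_iff_two_pow_dvd_sub_one {a s : ℕ} (ha : 2 ≤ a) {u c x : ℤ}
    (hs : 2 ≤ s) (hc : Odd c) (hu : u = -1 + 2 ^ s * c) (hx : 4 ∣ x - 1)
    {ubar xbar : (ZMod (2 ^ a))ˣ} (hub : (ubar : ZMod (2 ^ a)) = (u : ZMod (2 ^ a)))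
    (hxb : (xbar : ZMod (2 ^ a)) = (x : ZMod (2 ^ a))) :
    xbar ∈ Subgroup.zpowers ubar ↔ (2 : ℤ) ^ min (s + 1) a ∣ x - 1 := by
  have hpow : ∀ k : ℕ, ubar ^ k = xbar ↔ (2 : ℤ) ^ a ∣ x - u ^ k := by
    intro k
    rw [Units.ext_iff, Units.val_pow_eq_pow_val, hub, hxb, ← Int.cast_pow,
      ZMod.intCast_eq_intCast_iff_dvd_sub]
    push_cast
    rfl
  obtain ⟨r, rfl⟩ : ∃ r, s = r + 2 := ⟨s - 2, by omega⟩
  have hw : u ^ 2 = 1 + 2 ^ (r + 2 + 1) * (c * (2 ^ (r + 1) * c - 1)) := by rw [hu]; ring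
  have hmem : xbar ∈ Subgroup.zpowers ubar ↔ ∃ k : ℕ, (2 : ℤ) ^ a ∣ x - u ^ k := by
    simp only [← mem_powers_iff_mem_zpowers, Submonoid.mem_powers_iff, hpow]
  rw [hmem]
  constructor
  · rintro ⟨k, hk⟩
    have hu4 : (4 : ℤ) ∣ u - (-1) := ⟨2 ^ r * c, by rw [hu]; ring⟩
    have h4 : (4 : ℤ) ∣ x - u ^ k := (pow_dvd_pow (2 : ℤ) ha).trans hk
    rcases Nat.even_or_odd' k with ⟨l, rfl | rfl⟩
    · have h1 : (2 : ℤ) ^ (r + 2 + 1) ∣ u ^ (2 * l) - 1 := by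
        rw [pow_mul]
        exact (Dvd.intro _ (sub_eq_of_eq_add' hw).symm).trans (sub_one_dvd_pow_sub_one (u ^ 2) l)
      have := dvd_add ((pow_dvd_pow 2 (min_le_right (r + 2 + 1) a)).trans hk)
        ((pow_dvd_pow 2 (min_le_left (r + 2 + 1) a)).trans h1)
      simpa using this
    · have h1 := hu4.trans (sub_dvd_pow_sub_pow u (-1) (2 * l + 1))
      rw [Odd.neg_one_pow ⟨l, rfl⟩] at h1
      omega
  · intro hd
    rcases le_total a (r + 2 + 1) with hle | hle
    · rw [min_eq_right hle] at hd
      exact ⟨0, by simpa using hd⟩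
    · rw [min_eq_left hle] at hd
      have hodd : Odd (c * (2 ^ (r + 1) * c - 1)) :=
        hc.mul (Even.sub_odd (((even_two (α := ℤ)).pow_of_ne_zero (by omega)).mul_right _)
          odd_one)
      obtain ⟨k, hk⟩ :=
        Int.exists_two_pow_dvd_sub_pow (by omega) hodd hw hd (a - (r + 2 + 1))
      rw [Nat.add_sub_cancel' hle, ← pow_mul] at hk
      exact ⟨2 * k, hk⟩

theorem padicValInt.exists_odd_eq_two_pow_mul {z : ℤ} (hz : z ≠ 0) :
    ∃ c : ℤ, Odd c ∧ z = 2 ^ padicValInt 2 z * c := by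
  have hf : FiniteMultiplicity 2 z := Int.finiteMultiplicity_iff.mpr ⟨by norm_num, hz⟩
  obtain ⟨c, hc, hc'⟩ := hf.exists_eq_pow_mul_and_not_dvd
  rw [padicValInt.of_ne_one_ne_zero (by norm_num) hz]
  exact ⟨c, by rwa [← Int.not_even_iff_odd, even_iff_two_dvd], hc⟩

/-- Let `a ≥ 2` and let `h`, `u` be odd integers with `u ≠ -1`,
`ν₂(u-1) = 1` and `ν₂(h-1) ≥ 2`.  Let `hbar`, `ubar` be the residues of `h`, `u`
in `(ZMod (2^a))ˣ`.  Then the order of the image of `hbar` in the quotient group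
`(ZMod (2^a))ˣ / ⟨ubar⟩` equals `2 ^ v` where
`v = max (min (ν₂(u+1) + 1) a - ν₂(h-1)) 0`. -/
theorem order_in_quotient_case_ii (a : ℕ) (ha : 2 ≤ a) (h u : ℤ)
    (hh : Odd h) (hu : Odd u) (hune : u ≠ -1)
    (hvu : padicValInt 2 (u - 1) = 1) (hvh : 2 ≤ padicValInt 2 (h - 1))
    (ubar hbar : (ZMod (2 ^ a))ˣ)
    (hub : (ubar : ZMod (2 ^ a)) = (u : ZMod (2 ^ a)))
    (hhb : (hbar : ZMod (2 ^ a)) = (h : ZMod (2 ^ a))) :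
    orderOf (QuotientGroup.mk hbar : (ZMod (2 ^ a))ˣ ⧸ Subgroup.zpowers ubar) =
      2 ^ max (min (padicValInt 2 (u + 1) + 1) a - padicValInt 2 (h - 1)) 0 := by
  have hh1 : h ≠ 1 := by rintro rfl; simp at hvh
  have hu1 : u ≠ 1 := by rintro rfl; simp at hvu
  obtain ⟨c, hc, hcu⟩ := padicValInt.exists_odd_eq_two_pow_mul (z := u + 1) (by omega)
  obtain ⟨e, he, heu⟩ := padicValInt.exists_odd_eq_two_pow_mul (sub_ne_zero.mpr hu1)
  obtain ⟨d, -, hdh⟩ := padicValInt.exists_odd_eq_two_pow_mul (sub_ne_zero.mpr hh1)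
  have h4 : (4 : ℤ) ∣ h - 1 := (pow_dvd_pow (2 : ℤ) hvh).trans ⟨d, hdh⟩
  have hs : 2 ≤ padicValInt 2 (u + 1) := by
    rw [hvu] at heu
    obtain ⟨i, rfl⟩ := he
    obtain ⟨j, rfl⟩ := hc
    by_contra! hlt
    interval_cases padicValInt 2 (u + 1) <;> omega
  rw [Nat.max_zero, ← Nat.dvd_right_iff_eq]
  intro n
  rw [orderOf_dvd_iff_pow_eq_one, ← QuotientGroup.mk_pow, QuotientGroup.eq_one_iff,
    ZMod.mem_zpowers_iff_two_pow_dvd_sub_one (x := h ^ n) ha hs hc (by linarith)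
      (h4.trans (sub_one_dvd_pow_sub_one h n)) hub (by simp [hhb]),
    Int.two_pow_dvd_pow_sub_one_iff hh1 h4]
end

section
/- Let s be an integer with gcd(s, rn) = 1 and s ≡ 1 (mod r). For each prime p dividing gcd(n, r), set a_p = ν_p(n) + ν_p(r) = ν_p(rn), and let d_p be the order of the image of s in the quotient group (Z/p^{a_p} Z)^* / ⟨q̄⟩, where ⟨q̄⟩ is the cyclic subgroup generated by the residue of q (note gcd(q, rn) = 1, so q is a unit modulo p^{a_p}). Set M_s = ∏_{p | gcd(n,r)} d_p, the product over all primes p dividing gcd(n, r). Then, for a positive integer m, there exists a Type I m-adic splitting of 1+rZ_{rn} given by μ_s if and only if m divides M_s. -/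
/-- The subset `1 + r·Z_{rn}` of `Z_{rn} = ZMod (r*n)`, i.e. the residues
congruent to `1` modulo `r`. -/
def oneAddRZ (n r : ℕ) : Set (ZMod (r * n)) :=
  {x | ∃ k : ZMod (r * n), x = 1 + (r : ZMod (r * n)) * k}

/-- `X` is a Type I `m`-adic splitting of `1 + r·Z_{rn}` given by the multiplier
`μ_s`: a partition of `1 + r·Z_{rn}` into `m` pairwise disjoint subsets, indexed
cyclically by `ZMod m`, each invariant under `μ_q : x ↦ qx`, and with
`μ_s : x ↦ sx` carrying `X j` onto `X (j+1)` (subscripts modulo `m`). -/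
def IsTypeISplitting (q n r : ℕ) (s : ℤ) (m : ℕ)
    (X : ZMod m → Set (ZMod (r * n))) : Prop :=
  Pairwise (Function.onFun Disjoint X) ∧
  (⋃ j, X j) = oneAddRZ n r ∧
  (∀ j, (fun x => (q : ZMod (r * n)) * x) '' X j = X j) ∧
  (∀ j, (fun x => (s : ZMod (r * n)) * x) '' X j = X (j + 1))

/-- The order of the image of `s` in the quotient group `(ZMod N)ˣ / ⟨q̄⟩` (for
`N > 0` and `q`, `s` units modulo `N`): the least `d > 0` such that
`s^d ∈ ⟨q̄⟩`, i.e. `s^d = q^e` in `ZMod N` for some `e : ℕ`. -/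
noncomputable def quotOrder (N : ℕ) (q s : ℤ) : ℕ :=
  sInf {d : ℕ | 0 < d ∧ ∃ e : ℕ, (s : ZMod N) ^ d = (q : ZMod N) ^ e}

open scoped Pointwise

theorem exists_cyclic_splitting_iff {G α : Type*} [CommGroup G] [MulAction G α] (s q : G)
    (Y : Set α) (hY : ∀ a b : ℤ, ∀ x ∈ Y, (s ^ a * q ^ b) • x ∈ Y) (m : ℕ) :
    (∃ X : ZMod m → Set α, Pairwise (Function.onFun Disjoint X) ∧ (⋃ j, X j) = Y ∧
      (∀ j, q • X j = X j) ∧ (∀ j, s • X j = X (j + 1))) ↔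
      ∀ x ∈ Y, ∀ d e : ℤ, s ^ d • x = q ^ e • x → (m : ℤ) ∣ d := by
  constructor
  · rintro ⟨X, hdisj, hU, hq, hs⟩ x hx d e hde
    have hqz : ∀ (e : ℤ) (j : ZMod m), q ^ e • X j = X j := by
      intro e j
      have : q ∈ MulAction.stabilizer G (X j) := hq j
      exact (MulAction.stabilizer G (X j)).zpow_mem this e
    have hs' : ∀ j, s⁻¹ • X j = X (j - 1) := by
      intro j
      rw [inv_smul_eq_iff, hs, sub_add_cancel]
    have hsz : ∀ (d : ℤ) (j : ZMod m), s ^ d • X j = X (j + d) := by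
      intro d
      induction d with
      | zero => simp
      | succ k ih =>
        intro j
        rw [zpow_add_one, mul_smul, hs, ih]
        congr 1
        push_cast
        ring
      | pred k ih =>
        intro j
        rw [zpow_sub_one, mul_smul, hs', ih]
        congr 1
        push_cast
        ring
    rw [← hU] at hx
    obtain ⟨j, hj⟩ := Set.mem_iUnion.1 hx
    have h1 : s ^ d • x ∈ X (j + d) := hsz d j ▸ Set.smul_mem_smul_set hj
    have h2 : s ^ d • x ∈ X j := hde ▸ hqz e j ▸ Set.smul_mem_smul_set hj
    by_contra hd
    have hne : j + (d : ZMod m) ≠ j := by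
      intro h
      exact hd ((ZMod.intCast_zmod_eq_zero_iff_dvd d m).1 (by simpa using h))
    exact Set.disjoint_left.1 (hdisj hne) h1 h2
  · intro H
    let R := MulAction.orbitRel (Subgroup.closure {s, q}) α
    let rep : α → α := fun x => (Quotient.mk R x).out
    have hrep : ∀ x, ∃ a b : ℤ, x = (s ^ a * q ^ b) • rep x := by
      intro x
      have h : R x (rep x) := R.symm (Quotient.mk_out (s := R) x)
      obtain ⟨⟨g, hg⟩, hgx⟩ := h
      obtain ⟨a, b, rfl⟩ := Subgroup.mem_closure_pair.1 hg
      exact ⟨a, b, hgx.symm⟩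
    have hrep_smul : ∀ (a b : ℤ) x, rep ((s ^ a * q ^ b) • x) = rep x := by
      intro a b x
      have : Quotient.mk R ((s ^ a * q ^ b) • x) = Quotient.mk R x :=
        Quotient.sound ⟨⟨_, Subgroup.mem_closure_pair.2 ⟨a, b, rfl⟩⟩, rfl⟩
      exact congrArg Quotient.out this
    have huniq : ∀ x ∈ Y, ∀ a b a' b' : ℤ, x = (s ^ a * q ^ b) • rep x →
        x = (s ^ a' * q ^ b') • rep x → (a : ZMod m) = a' := by
      intro x hx a b a' b' h h'
      have hy : rep x = (s ^ a' * q ^ b')⁻¹ • x := by rw [eq_inv_smul_iff]; exact h'.symm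
      rw [hy, smul_smul] at h
      have := H x hx (a - a') (b' - b) (by
        conv_rhs => rw [h]
        rw [smul_smul]
        congr 1
        simp only [zpow_sub, mul_inv]
        have : ∀ A B C D : G, A * B⁻¹ = C * D⁻¹ * (A * D * (B⁻¹ * C⁻¹)) := by
          intro A B C D
          calc A * B⁻¹ = A * B⁻¹ * (C * C⁻¹) * (D * D⁻¹) := by simp
            _ = _ := by ac_rfl
        exact this _ _ _ _)
      rw [← sub_eq_zero, ← Int.cast_sub]
      exact (ZMod.intCast_zmod_eq_zero_iff_dvd _ m).2 this
    let X : ZMod m → Set α := fun j =>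
      {x | x ∈ Y ∧ ∃ a b : ℤ, x = (s ^ a * q ^ b) • rep x ∧ (a : ZMod m) = j}
    have hmove : ∀ (c d : ℤ) j, ∀ x ∈ X j, (s ^ c * q ^ d) • x ∈ X (j + c) := by
      rintro c d j x ⟨hx, a, b, hab, rfl⟩
      refine ⟨hY c d x hx, a + c, b + d, ?_, by push_cast; rfl⟩
      rw [hrep_smul]
      conv_lhs => rw [hab]
      rw [smul_smul, zpow_add, zpow_add]
      congr 1
      exact (mul_mul_mul_comm _ _ _ _).trans (by rw [mul_comm (s ^ c), mul_comm (q ^ d)])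
    refine ⟨X, ?_, ?_, ?_, ?_⟩
    · intro i j hij
      refine Set.disjoint_left.2 ?_
      rintro x ⟨hx, a, b, h, rfl⟩ ⟨-, a', b', h', rfl⟩
      exact hij (huniq x hx a b a' b' h h')
    · ext x
      simp only [Set.mem_iUnion]
      constructor
      · rintro ⟨j, hj⟩
        exact hj.1
      · intro hx
        obtain ⟨a, b, h⟩ := hrep x
        exact ⟨a, hx, a, b, h, rfl⟩
    · intro j
      ext x
      rw [Set.mem_smul_set_iff_inv_smul_mem]
      constructor
      · intro h
        simpa using hmove 0 1 j _ h
      · intro h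
        simpa using hmove 0 (-1) j _ h
    · intro j
      ext x
      rw [Set.mem_smul_set_iff_inv_smul_mem]
      constructor
      · intro h
        simpa using hmove 1 0 j _ h
      · intro h
        simpa using hmove (-1) 0 (j + 1) _ h

theorem mem_oneAddRZ_iff {n r : ℕ} {x : ZMod (r * n)} :
    x ∈ oneAddRZ n r ↔ ZMod.castHom (dvd_mul_right r n) (ZMod r) x = 1 := by
  constructor
  · rintro ⟨k, rfl⟩
    rw [map_add, map_mul, map_natCast, map_one]
    simp
  · obtain ⟨z, rfl⟩ := ZMod.intCast_surjective x
    intro h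
    rw [map_intCast] at h
    obtain ⟨k, hk⟩ := (ZMod.intCast_zmod_eq_zero_iff_dvd (z - 1) r).1 (by simp [h])
    refine ⟨k, ?_⟩
    rw [show z = 1 + r * k by linarith]
    push_cast
    rfl

theorem quotOrder_eq_orderOf {N : ℕ} [NeZero N] {q s : ℤ} (Q S : (ZMod N)ˣ)
    (hQ : (Q : ZMod N) = q) (hS : (S : ZMod N) = s) :
    quotOrder N q s = orderOf (S : (ZMod N)ˣ ⧸ Subgroup.zpowers Q) := by
  have key : ∀ d : ℕ, (∃ e : ℕ, (s : ZMod N) ^ d = (q : ZMod N) ^ e) ↔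
      (S : (ZMod N)ˣ ⧸ Subgroup.zpowers Q) ^ d = 1 := by
    intro d
    rw [← QuotientGroup.mk_pow, QuotientGroup.eq_one_iff, ← mem_powers_iff_mem_zpowers,
      Submonoid.mem_powers_iff]
    simp only [← hQ, ← hS, ← Units.val_pow_eq_pow_val, Units.val_inj, eq_comm]
  have hmem : orderOf (S : (ZMod N)ˣ ⧸ Subgroup.zpowers Q) ∈
      {d : ℕ | 0 < d ∧ ∃ e : ℕ, (s : ZMod N) ^ d = (q : ZMod N) ^ e} :=
    ⟨orderOf_pos (S : (ZMod N)ˣ ⧸ Subgroup.zpowers Q), (key _).2 (pow_orderOf_eq_one _)⟩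
  refine le_antisymm (Nat.sInf_le hmem) ?_
  obtain ⟨h0, h1⟩ := Nat.sInf_mem ⟨_, hmem⟩
  exact orderOf_le_of_pow_eq_one h0 ((key _).1 h1)

theorem intCast_pow_prime_pow_eq_one {p : ℕ} {s : ℤ} (h : (p : ℤ) ∣ s - 1) (a : ℕ) :
    (s : ZMod (p ^ a)) ^ p ^ a = 1 := by
  have := dvd_sub_pow_of_dvd_sub h a
  rw [one_pow] at this
  have h2 := (ZMod.intCast_zmod_eq_zero_iff_dvd (s ^ p ^ a - 1) (p ^ a)).2 (by
    push_cast
    exact (pow_dvd_pow _ (Nat.le_succ a)).trans this)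
  push_cast at h2
  exact sub_eq_zero.1 (by exact_mod_cast h2)

theorem quotOrder_dvd_prime_pow {p : ℕ} (hp : p.Prime) {q s : ℤ} (hq : (p : ℤ) ∣ q - 1)
    (hs : (p : ℤ) ∣ s - 1) (a : ℕ) : quotOrder (p ^ a) q s ∣ p ^ a := by
  have : NeZero (p ^ a) := ⟨pow_ne_zero _ hp.ne_zero⟩
  obtain ⟨Q, hQ⟩ := IsUnit.of_pow_eq_one (intCast_pow_prime_pow_eq_one hq a)
    (pow_ne_zero _ hp.ne_zero)
  obtain ⟨S, hS⟩ := IsUnit.of_pow_eq_one (intCast_pow_prime_pow_eq_one hs a)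
    (pow_ne_zero _ hp.ne_zero)
  rw [quotOrder_eq_orderOf Q S hQ hS]
  apply orderOf_dvd_of_pow_eq_one
  rw [← QuotientGroup.mk_pow, show S ^ p ^ a = 1 from Units.ext (by
    rw [Units.val_pow_eq_pow_val, hS, intCast_pow_prime_pow_eq_one hs, Units.val_one])]
  rfl

theorem exists_pow_eq_of_quotOrder_dvd {p : ℕ} (hp : p.Prime) {q s : ℤ}
    (hq : (p : ℤ) ∣ q - 1) (hs : (p : ℤ) ∣ s - 1) (a : ℕ) {d : ℕ}
    (hd : quotOrder (p ^ a) q s ∣ d) :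
    ∃ e : ℕ, (s : ZMod (p ^ a)) ^ d = (q : ZMod (p ^ a)) ^ e := by
  have : NeZero (p ^ a) := ⟨pow_ne_zero _ hp.ne_zero⟩
  obtain ⟨Q, hQ⟩ := IsUnit.of_pow_eq_one (intCast_pow_prime_pow_eq_one hq a)
    (pow_ne_zero _ hp.ne_zero)
  obtain ⟨S, hS⟩ := IsUnit.of_pow_eq_one (intCast_pow_prime_pow_eq_one hs a)
    (pow_ne_zero _ hp.ne_zero)
  rw [quotOrder_eq_orderOf Q S hQ hS, orderOf_dvd_iff_pow_eq_one, ← QuotientGroup.mk_pow,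
    QuotientGroup.eq_one_iff, ← mem_powers_iff_mem_zpowers, Submonoid.mem_powers_iff] at hd
  obtain ⟨e, he⟩ := hd
  refine ⟨e, ?_⟩
  rw [← hQ, ← hS, ← Units.val_pow_eq_pow_val, ← Units.val_pow_eq_pow_val, he]

theorem exists_uniform_pow_eq (P : Finset ℕ) (hP : ∀ p ∈ P, p.Prime) (f : ℕ → ℕ) {q s : ℤ}
    (hq : ∀ p ∈ P, (p : ℤ) ∣ q - 1) (hs : ∀ p ∈ P, (p : ℤ) ∣ s - 1) :
    ∃ e : ℕ, ∀ p ∈ P, (s : ZMod (p ^ f p)) ^ (∏ p ∈ P, quotOrder (p ^ f p) q s) =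
      (q : ZMod (p ^ f p)) ^ e := by
  have h : ∀ p, ∃ e : ℕ, p ∈ P → (s : ZMod (p ^ f p)) ^ (∏ p ∈ P, quotOrder (p ^ f p) q s) =
      (q : ZMod (p ^ f p)) ^ e := by
    intro p
    by_cases hp : p ∈ P
    · obtain ⟨e, he⟩ := exists_pow_eq_of_quotOrder_dvd (hP p hp) (hq p hp) (hs p hp) (f p)
        (Finset.dvd_prod_of_mem (fun p => quotOrder (p ^ f p) q s) hp)
      exact ⟨e, fun _ => he⟩
    · exact ⟨0, fun h => absurd h hp⟩
  choose e he using h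
  obtain ⟨k, hk⟩ := Nat.chineseRemainderOfFinset e (fun p => p ^ f p) P
    (fun p hp => pow_ne_zero _ (hP p hp).ne_zero)
    (fun p hp p' hp' hne => Nat.Coprime.pow _ _ ((Nat.coprime_primes (hP p hp) (hP p' hp')).2 hne))
  refine ⟨k, fun p hp => (he p hp).trans ?_⟩
  have h1 := intCast_pow_prime_pow_eq_one (hq p hp) (f p)
  rw [pow_eq_pow_mod (e p) h1, pow_eq_pow_mod k h1]
  congr 1
  exact (hk p hp).symm

theorem prime_pow_dvd_one_sub_pow {p n r : ℕ} (hp : p.Prime) (hpn : p ∣ n) (hn : 0 < n)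
    (hpr : ¬ p ∣ r) {k : ℕ} (hk : k ≤ n) :
    (p : ℤ) ^ k ∣ (1 - (r : ℤ) ^ n.factorial) ^ n := by
  have := Fact.mk hp
  refine (pow_dvd_pow _ hk).trans (pow_dvd_pow_of_dvd ?_ n)
  rw [← ZMod.intCast_zmod_eq_zero_iff_dvd]
  push_cast
  obtain ⟨c, hc⟩ : p - 1 ∣ n.factorial := Nat.dvd_factorial (Nat.sub_pos_of_lt hp.one_lt)
    ((Nat.sub_le _ _).trans (Nat.le_of_dvd hn hpn))
  rw [hc, pow_mul, ZMod.pow_card_sub_one_eq_one, one_pow, sub_self]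
  rwa [Ne, ZMod.natCast_eq_zero_iff]

theorem int_dvd_of_forall_prime_pow_factorization_dvd {N : ℕ} (hN : N ≠ 0) {z : ℤ}
    (h : ∀ p, p.Prime → p ∣ N → (p : ℤ) ^ N.factorization p ∣ z) : (N : ℤ) ∣ z := by
  rw [Int.natCast_dvd, Nat.dvd_iff_prime_pow_dvd_dvd]
  intro p k hp hk
  rcases Nat.eq_zero_or_pos k with rfl | hk0
  · simp
  · have hle := (hp.pow_dvd_iff_le_factorization hN).1 hk
    refine (pow_dvd_pow p hle).trans ?_
    rw [← Int.natCast_dvd]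
    exact_mod_cast h p hp ((dvd_pow_self p hk0.ne').trans hk)

/-- Let `s` be an integer with `gcd(s, rn) = 1` and
`s ≡ 1 (mod r)`.  Setting `M_s = ∏_{p ∣ gcd(n,r)} d_p`, where `d_p` is the order
of the image of `s` in `(Z/p^{ν_p(rn)})ˣ / ⟨q̄⟩`, a Type I `m`-adic splitting of
`1 + r·Z_{rn}` given by `μ_s` exists iff `m ∣ M_s`. -/
theorem typeI_splitting_iff_dvd_prod (q n r : ℕ) (hq : IsPrimePow q)
    (hn : 0 < n) (hqn : Nat.gcd q n = 1) (hr : 0 < r) (hrdvd : r ∣ q - 1)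
    (s : ℤ) (hs : Int.gcd s (r * n) = 1) (hsr : (r : ℤ) ∣ s - 1)
    (m : ℕ) (hm : 0 < m) :
    (∃ X : ZMod m → Set (ZMod (r * n)), IsTypeISplitting q n r s m X) ↔
      m ∣ ∏ p ∈ (Nat.gcd n r).primeFactors,
            quotOrder (p ^ (r * n).factorization p) (q : ℤ) s := by
  have hrn : r * n ≠ 0 := (Nat.mul_pos hr hn).ne'
  have hqr : (r : ℤ) ∣ (q : ℤ) - 1 := by
    have := Int.natCast_dvd_natCast.2 hrdvd
    rwa [Nat.cast_sub hq.one_lt.le, Nat.cast_one] at this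
  have hqr' : Nat.Coprime q r := by
    refine Nat.isCoprime_iff_coprime.1 ?_
    obtain ⟨c, hc⟩ := hqr
    exact ⟨1, -c, by linarith⟩
  obtain ⟨Q, hQ⟩ : IsUnit (q : ZMod (r * n)) :=
    (ZMod.isUnit_iff_coprime q (r * n)).2 (hqr'.mul_right hqn)
  obtain ⟨S, hS⟩ : IsUnit (s : ZMod (r * n)) := by
    rw [ZMod.coe_int_isUnit_iff_isCoprime, Nat.cast_mul]
    exact (Int.isCoprime_iff_gcd_eq_one.2 hs).symm
  have cast_one : ∀ z : ℤ, (r : ℤ) ∣ z - 1 → (z : ZMod r) = 1 := fun z hz => by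
    have := (ZMod.intCast_zmod_eq_zero_iff_dvd _ r).2 hz
    rwa [Int.cast_sub, Int.cast_one, sub_eq_zero] at this
  have hYmem : ∀ a b : ℤ, ∀ x ∈ oneAddRZ n r, (S ^ a * Q ^ b) • x ∈ oneAddRZ n r := by
    intro a b x hx
    rw [mem_oneAddRZ_iff] at hx ⊢
    set φ := ZMod.castHom (dvd_mul_right r n) (ZMod r)
    have h1 : Units.map (φ : ZMod (r * n) →* ZMod r) S = 1 := Units.ext (by
      simpa [hS] using cast_one s hsr)
    have h2 : Units.map (φ : ZMod (r * n) →* ZMod r) Q = 1 := Units.ext (by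
      simpa [hQ] using cast_one q hqr)
    have h3 : Units.map (φ : ZMod (r * n) →* ZMod r) (S ^ a * Q ^ b) = 1 := by
      rw [map_mul, map_zpow, map_zpow, h1, h2, one_zpow, one_zpow, one_mul]
    rw [Units.smul_def, smul_eq_mul, map_mul, hx, mul_one]
    exact congrArg Units.val h3
  have hsplit := exists_cyclic_splitting_iff S Q (oneAddRZ n r) hYmem m
  have himage : ∀ (U : (ZMod (r * n))ˣ) (A : Set (ZMod (r * n))),
      (fun x => (U : ZMod (r * n)) * x) '' A = U • A := fun _ _ => rfl
  have hL : (∃ X : ZMod m → Set (ZMod (r * n)), IsTypeISplitting q n r s m X) ↔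
      ∀ x ∈ oneAddRZ n r, ∀ d e : ℤ, S ^ d • x = Q ^ e • x → (m : ℤ) ∣ d := by
    rw [← hsplit]
    simp only [IsTypeISplitting, ← hQ, ← hS, himage]
  rw [hL]
  have hdvd : ∀ p ∈ (Nat.gcd n r).primeFactors, (p : ℤ) ∣ r := fun p hp =>
    Int.natCast_dvd_natCast.2 ((Nat.dvd_of_mem_primeFactors hp).trans (Nat.gcd_dvd_right n r))
  have hprime : ∀ p ∈ (Nat.gcd n r).primeFactors, p.Prime :=
    fun p hp => Nat.prime_of_mem_primeFactors hp
  constructor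
  · intro H
    obtain ⟨e, he⟩ := exists_uniform_pow_eq (Nat.gcd n r).primeFactors hprime
      (fun p => (r * n).factorization p) (fun p hp => (hdvd p hp).trans hqr)
      (fun p hp => (hdvd p hp).trans hsr)
    set D := ∏ p ∈ (Nat.gcd n r).primeFactors,
      quotOrder (p ^ (r * n).factorization p) (q : ℤ) s
    let x : ℤ := (1 - (r : ℤ) ^ n.factorial) ^ n
    have hx : (x : ZMod (r * n)) ∈ oneAddRZ n r := by
      rw [mem_oneAddRZ_iff, map_intCast]
      simp [x, Nat.factorial_ne_zero]
    have hdiv : ((r * n : ℕ) : ℤ) ∣ (s ^ D - (q : ℤ) ^ e) * x := by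
      refine int_dvd_of_forall_prime_pow_factorization_dvd hrn fun p hp hprn => ?_
      have hfac : (r * n).factorization p = r.factorization p + n.factorization p := by
        rw [Nat.factorization_mul hr.ne' hn.ne', Finsupp.add_apply]
      by_cases hpr : p ∣ r
      · refine Dvd.dvd.mul_right ?_ _
        by_cases hpn : p ∣ n
        · have := he p (Nat.mem_primeFactors.2 ⟨hp, Nat.dvd_gcd hpn hpr,
            (Nat.gcd_pos_of_pos_left _ hn).ne'⟩)
          have h2 := (ZMod.intCast_zmod_eq_zero_iff_dvd (s ^ D - (q : ℤ) ^ e)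
            (p ^ (r * n).factorization p)).1 (by
              push_cast
              rw [sub_eq_zero]
              simpa using this)
          exact_mod_cast h2
        · rw [hfac, Nat.factorization_eq_zero_of_not_dvd hpn, add_zero]
          have h1 : (p : ℤ) ^ r.factorization p ∣ r := by
            exact_mod_cast Nat.ordProj_dvd r p
          refine h1.trans ?_
          have h2 := sub_dvd_pow_sub_pow s 1 D
          have h3 := sub_dvd_pow_sub_pow (q : ℤ) 1 e
          rw [one_pow] at h2 h3
          simpa using dvd_sub (hsr.trans h2) (hqr.trans h3)
      · refine Dvd.dvd.mul_left ?_ _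
        rw [hfac, Nat.factorization_eq_zero_of_not_dvd hpr, zero_add]
        exact prime_pow_dvd_one_sub_pow hp ((hp.dvd_mul.1 hprn).resolve_left hpr) hn hpr
          (Nat.factorization_lt p hn.ne').le
    have hfinal := (ZMod.intCast_zmod_eq_zero_iff_dvd _ _).2 hdiv
    have := H x hx D e (by
      rw [zpow_natCast, zpow_natCast, Units.smul_def, Units.smul_def, smul_eq_mul, smul_eq_mul,
        Units.val_pow_eq_pow_val, Units.val_pow_eq_pow_val, hS, hQ, ← sub_eq_zero, ← sub_mul]
      exact_mod_cast hfinal)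
    exact_mod_cast this
  · intro hmD x hx d e hde
    refine (Int.natCast_dvd_natCast.2 hmD).trans ?_
    rw [Int.natCast_dvd]
    refine Finset.prod_dvd_of_isRelPrime ?_ ?_
    · intro p hp p' hp' hne
      have hd : ∀ p ∈ (Nat.gcd n r).primeFactors,
          quotOrder (p ^ (r * n).factorization p) (q : ℤ) s ∣ p ^ (r * n).factorization p :=
        fun p hp => quotOrder_dvd_prime_pow (hprime p hp) ((hdvd p hp).trans hqr)
          ((hdvd p hp).trans hsr) _
      exact Nat.coprime_iff_isRelPrime.1 (Nat.Coprime.of_dvd (hd p hp) (hd p' hp')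
        (Nat.Coprime.pow _ _ ((Nat.coprime_primes (hprime p hp) (hprime p' hp')).2 hne)))
    · intro p hp
      set a := (r * n).factorization p
      have : NeZero (p ^ a) := ⟨pow_ne_zero _ (hprime p hp).ne_zero⟩
      set φ := ZMod.castHom (Nat.ordProj_dvd (r * n) p) (ZMod (p ^ a))
      set ψ := Units.map (φ : ZMod (r * n) →* ZMod (p ^ a))
      have hxu : IsUnit (φ x) := by
        obtain ⟨k, rfl⟩ := hx
        obtain ⟨k, rfl⟩ := ZMod.intCast_surjective k
        refine IsUnit.of_pow_eq_one (n := p ^ a) ?_ (NeZero.ne _)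
        have := intCast_pow_prime_pow_eq_one (p := p) (s := 1 + r * k)
          (by simpa using (hdvd p hp).mul_right k) a
        simpa using this
      have hSQ : ψ S ^ d = ψ Q ^ e := by
        have h := congrArg φ hde
        rw [Units.smul_def, Units.smul_def, smul_eq_mul, smul_eq_mul, map_mul, map_mul] at h
        have h' : ψ (S ^ d) = ψ (Q ^ e) := Units.ext (hxu.mul_right_cancel h)
        rwa [map_zpow, map_zpow] at h'
      rw [quotOrder_eq_orderOf (ψ Q) (ψ S) (by simp [ψ, hQ]) (by simp [ψ, hS]),
        ← Int.natCast_dvd, orderOf_dvd_iff_zpow_eq_one, ← QuotientGroup.mk_zpow,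
        QuotientGroup.eq_one_iff, hSQ]
      exact Subgroup.zpow_mem_zpowers _ _
end

section
/- For a positive integer m, there exist an integer s with gcd(s, rn) = 1 and s ≡ 1 (mod r) and a Type I m-adic splitting of 1+rZ_{rn} given by μ_s if and only if, for every prime p, the p-adic valuation ν_p(m) of m is at most ν_p(M), where ν_p(M) is defined as follows: if p does not divide r or p does not divide n, then ν_p(M) = 0; otherwise: (i) if p is odd or ν_p(r) ≥ 2, then ν_p(M) = min{ν_p(q−1) − ν_p(r), ν_p(n)}; (ii) if p = 2 and ν₂(r) = 1, then: (ii.1) if ν₂(q−1) ≥ 2, then ν₂(M) = max{ min{ν₂(q−1)−2, ν₂(n)−1}, 1 }; (ii.2) if ν₂(q−1) = 1, then ν₂(M) = min{ν₂(q+1)−1, ν₂(n)−1}. (Equivalently: Type I m-adic (q,n,r)-constacyclic codes exist if and only if m divides M = ∏_p p^{ν_p(M)}.) -/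
lemma pow_succ_dvd_pow_prime_sub_one {p d : ℕ} (hd : 1 ≤ d) {x : ℤ}
    (h : (p : ℤ) ^ d ∣ x - 1) : (p : ℤ) ^ (d + 1) ∣ x ^ p - 1 := by
  have hp : (p : ℤ) ∣ x - 1 := (dvd_pow_self _ (by omega)).trans h
  have hsum : (p : ℤ) ∣ ∑ i ∈ Finset.range p, x ^ i * 1 ^ (p - 1 - i) := by
    rw [← ZMod.intCast_zmod_eq_zero_iff_dvd] at hp ⊢
    have hx : (x : ZMod p) = 1 := by
      push_cast at hp
      exact sub_eq_zero.mp hp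
    simp [hx]
  have key := geom_sum₂_mul x 1 p
  rw [one_pow] at key
  rw [← key, pow_succ, mul_comm]
  exact mul_dvd_mul hsum h

lemma pow_add_dvd_pow_sub_one {p d e k : ℕ} (hd : 1 ≤ d) {x : ℤ}
    (h : (p : ℤ) ^ d ∣ x - 1) (hk : p ^ e ∣ k) : (p : ℤ) ^ (d + e) ∣ x ^ k - 1 := by
  have hpow : (p : ℤ) ^ (d + e) ∣ x ^ p ^ e - 1 := by
    clear hk
    induction e with
    | zero => simpa using h
    | succ e ih =>
      rw [pow_succ, pow_mul]
      exact pow_succ_dvd_pow_prime_sub_one (d := d + e) (by omega) ih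
  obtain ⟨t, rfl⟩ := hk
  rw [pow_mul]
  exact hpow.trans (sub_one_dvd_pow_sub_one _ _)

/-- The exponent form of the lifting-the-exponent lemma. -/
lemma pow_dvd_of_pow_add_dvd_pow_sub_one {p v f k : ℕ} (hp : p.Prime)
    (hv : 1 ≤ v) (hpv : p ≠ 2 ∨ 2 ≤ v) {x : ℤ} (h : (p : ℤ) ^ v ∣ x - 1)
    (h' : ¬ (p : ℤ) ^ (v + 1) ∣ x - 1) (hk : (p : ℤ) ^ (v + f) ∣ x ^ k - 1) :
    p ^ f ∣ k := by
  have hpx : (p : ℤ) ∣ x - 1 := (dvd_pow_self _ (by omega)).trans h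
  have hpx' : ¬ (p : ℤ) ∣ x := fun hd => by
    have h1 : (p : ℤ) ∣ 1 := by simpa using dvd_sub hd hpx
    exact hp.one_lt.ne' (by exact_mod_cast Int.eq_one_of_dvd_one (by positivity) h1)
  have lte : emultiplicity (p : ℤ) (x ^ k - 1) =
      emultiplicity (p : ℤ) (x - 1) + emultiplicity p k := by
    rcases hp.eq_two_or_odd' with rfl | hodd
    · have h4 : (4 : ℤ) ∣ x - 1 := by
        have : ((2 : ℕ) : ℤ) ^ 2 ∣ x - 1 := (pow_dvd_pow _ (by omega)).trans h
        norm_num at this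
        exact this
      have := Int.two_pow_sub_pow' (y := 1) k h4 (by exact_mod_cast hpx')
      rw [one_pow] at this
      rw [← Int.natCast_emultiplicity 2 k]
      exact_mod_cast this
    · simpa using Int.emultiplicity_pow_sub_pow hp hodd (y := 1) hpx hpx' k
  rw [pow_dvd_iff_le_emultiplicity, lte, emultiplicity_eq_coe.mpr ⟨h, h'⟩] at hk
  rw [pow_dvd_iff_le_emultiplicity]
  push_cast at hk
  exact (ENat.add_le_add_iff_left (ENat.natCast_ne_top v)).mp hk

lemma pow_succ_dvd_one_add_pow_sub {p c : ℕ} (hc : 1 ≤ c) (u : ℤ) (l : ℕ) :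
    (p : ℤ) ^ (c + 1) ∣ (1 + (p : ℤ) ^ c * u) ^ l - (1 + l * (p ^ c * u)) := by
  induction l with
  | zero => simp
  | succ l ih =>
    have h2 : (p : ℤ) ^ (c + 1) ∣ (p : ℤ) ^ c * p ^ c := by
      rw [← pow_add]
      exact pow_dvd_pow _ (by omega)
    have heq : (1 + (p : ℤ) ^ c * u) ^ (l + 1) - (1 + (l + 1 : ℕ) * (p ^ c * u)) =
        ((1 + (p : ℤ) ^ c * u) ^ l - (1 + l * (p ^ c * u))) * (1 + (p : ℤ) ^ c * u) +
          (p : ℤ) ^ c * p ^ c * (l * u * u) := by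
      push_cast
      ring
    rw [heq]
    exact dvd_add (ih.mul_right _) (h2.mul_right _)

/-- Any integer `x ≡ 1` with `ν_p(x - 1) = v` generates the residues `≡ 1 mod p ^ v`
modulo every power of `p`, unless `p = 2` and `v = 1`. -/
lemma exists_pow_dvd_sub_pow {p v : ℕ} (hp : p.Prime)
    (hv : 1 ≤ v) (hpv : p ≠ 2 ∨ 2 ≤ v) {x y : ℤ} (h : (p : ℤ) ^ v ∣ x - 1)
    (h' : ¬ (p : ℤ) ^ (v + 1) ∣ x - 1) (hy : (p : ℤ) ^ v ∣ y - 1) (c : ℕ) :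
    ∃ j : ℕ, (p : ℤ) ^ c ∣ y - x ^ j := by
  rcases le_total c v with hcv | hcv
  · exact ⟨0, by simpa using (pow_dvd_pow _ hcv).trans hy⟩
  obtain ⟨f, rfl⟩ := Nat.exists_eq_add_of_le hcv
  clear hcv
  induction f with
  | zero => exact ⟨0, by simpa using hy⟩
  | succ f ih =>
    obtain ⟨j, w, hw⟩ := ih
    obtain ⟨u, hu⟩ := pow_add_dvd_pow_sub_one hv h (dvd_refl (p ^ f))
    have hpu : ¬ (p : ℤ) ∣ u := by
      rintro ⟨u', rfl⟩
      have hd : (p : ℤ) ^ (v + (f + 1)) ∣ x ^ p ^ f - 1 := by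
        rw [hu]
        exact ⟨u', by ring⟩
      have := pow_dvd_of_pow_add_dvd_pow_sub_one hp hv hpv h h' hd
      have := (Nat.pow_dvd_pow_iff_le_right hp.one_lt).mp this
      omega
    have hpx : (p : ℤ) ∣ x - 1 := (dvd_pow_self _ (by omega)).trans h
    have hP : Prime (p : ℤ) := Nat.prime_iff_prime_int.mp hp
    have hpx' : ¬ (p : ℤ) ∣ x := fun hd => by
      have h1 : (p : ℤ) ∣ 1 := by simpa using dvd_sub hd hpx
      exact hP.not_dvd_one h1
    have hA : ¬ (p : ℤ) ∣ x ^ j * u := by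
      rw [hP.dvd_mul]
      rintro (h1 | h1)
      · exact hpx' (hP.dvd_of_dvd_pow h1)
      · exact hpu h1
    obtain ⟨a, b, hab⟩ := ((Prime.coprime_iff_not_dvd hP).mpr hA)
    have hp0 : (p : ℤ) ≠ 0 := hP.ne_zero
    set l : ℕ := (w * b % p).toNat with hl
    have hlz : (l : ℤ) = w * b - p * (w * b / p) := by
      rw [hl, Int.toNat_of_nonneg (Int.emod_nonneg _ hp0), Int.emod_def]
    refine ⟨j + p ^ f * l, ?_⟩
    have hx : x ^ p ^ f = 1 + (p : ℤ) ^ (v + f) * u := by linarith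
    obtain ⟨z, hz⟩ := pow_succ_dvd_one_add_pow_sub (p := p) (c := v + f) (by omega) u l
    rw [pow_add x, pow_mul, hx]
    rw [sub_eq_iff_eq_add] at hz
    rw [hz]
    have hy' : y = (p : ℤ) ^ (v + f) * w + x ^ j := by linarith
    refine ⟨w * a + x ^ j * u * (w * b / p) - x ^ j * z, ?_⟩
    rw [hlz]
    have hw' : w = w * (a * p + b * (x ^ j * u)) := by rw [hab, mul_one]
    rw [hy']
    linear_combination (p : ℤ) ^ (v + f) * hw'

/-- Upper bound on the order modulo powers of `q`, in the case where the residues `≡ 1 mod p ^ a`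
form a cyclic group modulo every power of `p`. -/
lemma exists_pow_dvd_pow_sub_pow {p a b v : ℕ} (hp : p.Prime) (ha : 1 ≤ a)
    (hpa : p ≠ 2 ∨ 2 ≤ a) (hav : a ≤ v) {q s : ℤ} (h : (p : ℤ) ^ v ∣ q - 1)
    (h' : ¬ (p : ℤ) ^ (v + 1) ∣ q - 1) (hs : (p : ℤ) ^ a ∣ s - 1) :
    ∃ j : ℕ, (p : ℤ) ^ (a + b) ∣ s ^ p ^ min (v - a) b - q ^ j := by
  have hse := pow_add_dvd_pow_sub_one ha hs (dvd_refl (p ^ min (v - a) b))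
  rcases le_total (v - a) b with hvb | hvb
  · rw [min_eq_left hvb] at hse ⊢
    rw [show a + (v - a) = v by omega] at hse
    exact exists_pow_dvd_sub_pow hp (by omega) (by omega) h h' hse _
  · rw [min_eq_right hvb] at hse ⊢
    exact ⟨0, by simpa using hse⟩

lemma pow_min_dvd_of_dvd_pow_sub_pow {p a b v : ℕ} (hp : p.Prime) (ha : 1 ≤ a)
    (hpa : p ≠ 2 ∨ 2 ≤ a) (hav : a ≤ v) {q : ℤ} (h : (p : ℤ) ^ v ∣ q - 1) {k i : ℕ}
    (hk : (p : ℤ) ^ (a + b) ∣ (1 + (p : ℤ) ^ a) ^ k - q ^ i) :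
    p ^ min (v - a) b ∣ k := by
  have hp0 : (p : ℤ) ^ a ≠ 0 := pow_ne_zero _ (by exact_mod_cast hp.ne_zero)
  refine pow_dvd_of_pow_add_dvd_pow_sub_one hp ha hpa (x := 1 + (p : ℤ) ^ a) (by simp) ?_ ?_
  · rw [add_sub_cancel_left, pow_succ]
    intro hd
    have := (mul_dvd_mul_iff_left hp0).mp (by simpa using hd : (p : ℤ) ^ a * p ∣ p ^ a * 1)
    exact (Nat.prime_iff_prime_int.mp hp).not_dvd_one this
  · have h1 : (p : ℤ) ^ (a + min (v - a) b) ∣ q ^ i - 1 :=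
      ((pow_dvd_pow _ (by omega)).trans h).trans (sub_one_dvd_pow_sub_one _ _)
    have h2 := (pow_dvd_pow (p : ℤ) (by omega : a + min (v - a) b ≤ a + b)).trans hk
    simpa using dvd_add h2 h1

/-- The exponent of `p` in the largest `m` for which a Type I `m`-adic splitting exists. -/
def splittingExponent (q n r p : ℕ) : ℕ :=
  if p ∣ r ∧ p ∣ n then
    (if p ≠ 2 ∨ 2 ≤ r.factorization p then
      min ((q - 1).factorization p - r.factorization p) (n.factorization p)
    else if 2 ≤ (q - 1).factorization 2 then
      max (min ((q - 1).factorization 2 - 2) (n.factorization 2 - 1)) 1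
    else
      min ((q + 1).factorization 2 - 1) (n.factorization 2 - 1))
  else 0

lemma intCast_pow_dvd_iff_le_factorization {p N k : ℕ} (hp : p.Prime) (hN : N ≠ 0) :
    (p : ℤ) ^ k ∣ (N : ℤ) ↔ k ≤ N.factorization p := by
  rw [← hp.pow_dvd_iff_le_factorization hN]
  exact_mod_cast Iff.rfl

lemma pow_dvd_sub_one_iff {p q k : ℕ} (hp : p.Prime) (hq : 2 ≤ q) :
    (p : ℤ) ^ k ∣ (q : ℤ) - 1 ↔ k ≤ (q - 1).factorization p := by
  rw [← intCast_pow_dvd_iff_le_factorization hp (by omega), Nat.cast_sub (by omega), Nat.cast_one]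

lemma two_pow_dvd_sq_sub_one_iff {q k : ℕ} (hq : 2 ≤ q) :
    (2 : ℤ) ^ k ∣ (q : ℤ) ^ 2 - 1 ↔
      k ≤ (q - 1).factorization 2 + (q + 1).factorization 2 := by
  have h := intCast_pow_dvd_iff_le_factorization (k := k) Nat.prime_two
    (N := (q - 1) * (q + 1)) (mul_ne_zero (by omega) (by omega))
  rw [Nat.factorization_mul (by omega) (by omega)] at h
  rw [Finsupp.add_apply] at h
  rw [← h, Nat.cast_mul, Nat.cast_sub (by omega)]
  push_cast
  rw [show (q : ℤ) ^ 2 - 1 = (q - 1) * (q + 1) by ring]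

/-- Powers of a unit `q` modulo `N` are closed under inversion. -/
lemma exists_dvd_sub_pow_of_dvd_mul_pow_sub {N : ℕ} {q z : ℤ} (hq : IsCoprime (N : ℤ) q)
    (hN : 0 < N) {c d : ℕ} (h : (N : ℤ) ∣ z * q ^ c - q ^ d) : ∃ j : ℕ, (N : ℤ) ∣ z - q ^ j := by
  have hT : ∃ T : ℕ, 1 ≤ T ∧ (q : ZMod N) ^ T = 1 := by
    obtain ⟨u, hu⟩ := (ZMod.coe_int_isUnit_iff_isCoprime q N).mpr hq
    refine ⟨N.totient, Nat.totient_pos.mpr hN, ?_⟩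
    rw [← hu, ← Units.val_pow_eq_pow_val, ZMod.pow_totient, Units.val_one]
  obtain ⟨T, hT1, hT⟩ := hT
  refine ⟨d + c * (T - 1), ?_⟩
  rw [← ZMod.intCast_zmod_eq_zero_iff_dvd] at h ⊢
  push_cast at h ⊢
  rw [sub_eq_zero] at h ⊢
  rw [pow_add, ← h, mul_assoc, ← pow_add, show c + c * (T - 1) = T * c by
    obtain ⟨T, rfl⟩ := Nat.exists_eq_add_of_le hT1; simp; ring, pow_mul, hT, one_pow, mul_one]

lemma two_exists_pow_dvd_of_four_dvd {b : ℕ} {q s : ℤ} {v : ℕ} (hv : 2 ≤ v) (hb : 1 ≤ b)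
    (h : (2 : ℤ) ^ v ∣ q - 1) (h' : ¬ (2 : ℤ) ^ (v + 1) ∣ q - 1) (hs : (4 : ℤ) ∣ s - 1) :
    ∃ j : ℕ, (2 : ℤ) ^ (1 + b) ∣ s ^ 2 ^ min (v - 2) (b - 1) - q ^ j := by
  have := exists_pow_dvd_pow_sub_pow (a := 2) (b := b - 1) Nat.prime_two (by norm_num)
    (Or.inr le_rfl) hv (q := q) (s := s) (by exact_mod_cast h) (by exact_mod_cast h')
    (by norm_num; exact hs)
  rw [show 2 + (b - 1) = 1 + b by omega] at this
  exact_mod_cast this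

lemma pow_dvd_sub_pow_of_le {x y d : ℤ} {p e f : ℕ} (hef : e ≤ f) {j : ℕ}
    (h : d ∣ x ^ p ^ e - y ^ j) : ∃ j : ℕ, d ∣ x ^ p ^ f - y ^ j := by
  obtain ⟨g, rfl⟩ := Nat.exists_eq_add_of_le hef
  refine ⟨j * p ^ g, ?_⟩
  rw [pow_add, pow_mul, pow_mul]
  exact h.trans (sub_dvd_pow_sub_pow _ _ _)

lemma four_dvd_sub_one_or {s : ℤ} (hs : (2 : ℤ) ∣ s - 1) : (4 : ℤ) ∣ s - 1 ∨ (4 : ℤ) ∣ -s - 1 := by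
  omega

lemma exists_pow_dvd_pow_splittingExponent_sub {q n r p : ℕ} (hq : 2 ≤ q) (hn : 0 < n) (hr : 0 < r)
    (hrq : r ∣ q - 1) (hp : p.Prime) (hpr : p ∣ r) {s : ℤ}
    (hs : (p : ℤ) ^ r.factorization p ∣ s - 1) :
    ∃ j : ℕ, (p : ℤ) ^ (r * n).factorization p ∣
      s ^ p ^ splittingExponent q n r p - (q : ℤ) ^ j := by
  rw [Nat.factorization_mul hr.ne' hn.ne', Finsupp.add_apply]
  have ha : 1 ≤ r.factorization p := (hp.dvd_iff_one_le_factorization hr.ne').mp hpr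
  have hav : r.factorization p ≤ (q - 1).factorization p :=
    (Nat.factorization_le_iff_dvd hr.ne' (by omega)).mpr hrq p
  unfold splittingExponent
  by_cases hpn : p ∣ n
  swap
  · rw [if_neg (by tauto), Nat.factorization_eq_zero_of_not_dvd hpn]
    exact ⟨0, by simpa using hs⟩
  have hb : 1 ≤ n.factorization p := (hp.dvd_iff_one_le_factorization hn.ne').mp hpn
  rw [if_pos ⟨hpr, hpn⟩]
  have h := (pow_dvd_sub_one_iff (k := (q - 1).factorization p) hp hq).mpr le_rfl
  have h' : ¬ (p : ℤ) ^ ((q - 1).factorization p + 1) ∣ (q : ℤ) - 1 := by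
    rw [pow_dvd_sub_one_iff hp hq]
    omega
  split_ifs with hi hii
  · exact exists_pow_dvd_pow_sub_pow hp ha hi hav h h' hs
  · obtain ⟨rfl, ha2⟩ : p = 2 ∧ r.factorization p = 1 := by omega
    rw [ha2] at hs ⊢
    push_cast at hs h h' ⊢
    have hodd : (2 : ℤ) ∣ s - 1 := by simpa using hs
    rcases four_dvd_sub_one_or hodd with h4 | h4
    · obtain ⟨j, hj⟩ := two_exists_pow_dvd_of_four_dvd hii hb h h' h4
      exact pow_dvd_sub_pow_of_le (le_max_left _ _) hj
    · obtain ⟨j, hj⟩ := two_exists_pow_dvd_of_four_dvd hii hb h h' h4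
      obtain ⟨j, hj⟩ := pow_dvd_sub_pow_of_le (le_max_left _ 1) hj
      rw [Even.neg_pow (even_two.pow_of_ne_zero (by omega))] at hj
      exact ⟨j, hj⟩
  · obtain ⟨rfl, ha2⟩ : p = 2 ∧ r.factorization p = 1 := by omega
    rw [ha2] at hs ⊢
    push_cast at hs h h' ⊢
    have hodd : (2 : ℤ) ∣ s - 1 := by simpa using hs
    have hv : (q - 1).factorization 2 = 1 := by omega
    rw [hv] at h h'
    have hw : 2 ≤ (q + 1).factorization 2 := by
      rw [← Nat.prime_two.pow_dvd_iff_le_factorization (by omega)]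
      norm_num at h h' ⊢
      omega
    have hq2 := (two_pow_dvd_sq_sub_one_iff (k := 1 + (q + 1).factorization 2) hq).mpr (by omega)
    have hq2' : ¬ (2 : ℤ) ^ (1 + (q + 1).factorization 2 + 1) ∣ (q : ℤ) ^ 2 - 1 := by
      rw [two_pow_dvd_sq_sub_one_iff hq]
      omega
    have key := fun t ht => two_exists_pow_dvd_of_four_dvd (s := t) (by omega) hb hq2 hq2' ht
    rw [show 1 + (q + 1).factorization 2 - 2 = (q + 1).factorization 2 - 1 by omega] at key
    have h4 : (4 : ℤ) ∣ s - 1 ∨ (4 : ℤ) ∣ s * q - 1 := by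
      norm_num at h h'
      rcases four_dvd_sub_one_or hodd with h4 | h4
      · exact Or.inl h4
      · right
        obtain ⟨x, hx⟩ := h4
        obtain ⟨y, hy⟩ : (4 : ℤ) ∣ q + 1 := by omega
        exact ⟨-y - x * q, by linear_combination (-(q : ℤ)) * hx - hy⟩
    rcases h4 with h4 | h4
    · obtain ⟨j, hj⟩ := key s h4
      exact ⟨2 * j, by rwa [pow_mul]⟩
    · obtain ⟨j, hj⟩ := key (s * q) h4
      rw [mul_pow, ← pow_mul] at hj
      have hcop : IsCoprime (((2 ^ (1 + n.factorization 2) : ℕ)) : ℤ) (q : ℤ) := by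
        push_cast
        refine IsCoprime.pow_left ?_
        obtain ⟨c, hc⟩ := h
        exact ⟨-c, 1, by linarith⟩
      have := exists_dvd_sub_pow_of_dvd_mul_pow_sub hcop (by positivity) (by exact_mod_cast hj)
      exact_mod_cast this

lemma exists_pow_splittingExponent_dvd {q n r p : ℕ} (hq : 2 ≤ q) (hn : 0 < n) (hr : 0 < r)
    (hrq : r ∣ q - 1) (hp : p.Prime) :
    ∃ s : ℤ, (p : ℤ) ^ r.factorization p ∣ s - 1 ∧ (p ∣ r * n → (p : ℤ) ∣ s - 1) ∧
      ∀ k i : ℕ, (p ∣ r → (p : ℤ) ^ (r * n).factorization p ∣ s ^ k - (q : ℤ) ^ i) →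
        p ^ splittingExponent q n r p ∣ k := by
  by_cases hpr : p ∣ r
  swap
  · exact ⟨1, by simp, by simp, fun k i _ => by simp [splittingExponent, hpr]⟩
  rw [Nat.factorization_mul hr.ne' hn.ne', Finsupp.add_apply]
  have ha : 1 ≤ r.factorization p := (hp.dvd_iff_one_le_factorization hr.ne').mp hpr
  have hav : r.factorization p ≤ (q - 1).factorization p :=
    (Nat.factorization_le_iff_dvd hr.ne' (by omega)).mpr hrq p
  suffices H : ∃ s : ℤ, (p : ℤ) ^ r.factorization p ∣ s - 1 ∧
      ∀ k i : ℕ, (p : ℤ) ^ (r.factorization p + n.factorization p) ∣ s ^ k - (q : ℤ) ^ i →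
        p ^ splittingExponent q n r p ∣ k by
    obtain ⟨s, hs, h⟩ := H
    exact ⟨s, hs, fun _ => (dvd_pow_self _ (by omega)).trans hs, fun k i hk => h k i (hk hpr)⟩
  unfold splittingExponent
  by_cases hpn : p ∣ n
  swap
  · rw [if_neg (by tauto)]
    exact ⟨1, by simp, by simp⟩
  have hb : 1 ≤ n.factorization p := (hp.dvd_iff_one_le_factorization hn.ne').mp hpn
  rw [if_pos ⟨hpr, hpn⟩]
  have h := (pow_dvd_sub_one_iff (k := (q - 1).factorization p) hp hq).mpr le_rfl
  split_ifs with hi hii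
  · exact ⟨1 + (p : ℤ) ^ r.factorization p, by simp,
      fun k i hk => pow_min_dvd_of_dvd_pow_sub_pow hp ha hi hav h hk⟩
  · obtain ⟨rfl, ha2⟩ : p = 2 ∧ r.factorization p = 1 := by omega
    rw [ha2]
    rcases le_total (min ((q - 1).factorization 2 - 2) (n.factorization 2 - 1)) 1 with h1 | h1
    · rw [max_eq_right h1]
      refine ⟨3, by norm_num, fun k i hk => ?_⟩
      have h4 : (4 : ℤ) ∣ 3 ^ k - (q : ℤ) ^ i := by
        have := (pow_dvd_pow ((2 : ℕ) : ℤ) (by omega : 2 ≤ 1 + n.factorization 2)).trans hk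
        norm_num at this
        exact this
      have hq4 : (4 : ℤ) ∣ (q : ℤ) ^ i - 1 := by
        have := ((pow_dvd_pow ((2 : ℕ) : ℤ) hii).trans h).trans (sub_one_dvd_pow_sub_one _ i)
        norm_num at this
        exact this
      have h3 : (4 : ℤ) ∣ 3 ^ k - 1 := by simpa using dvd_add h4 hq4
      rw [pow_one, ← even_iff_two_dvd]
      by_contra hodd
      obtain ⟨c, rfl⟩ := Nat.not_even_iff_odd.mp hodd
      have h9 : (4 : ℤ) ∣ 9 ^ c - 1 :=
        (by norm_num : (4 : ℤ) ∣ 9 - 1).trans (sub_one_dvd_pow_sub_one _ _)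
      rw [pow_succ, pow_mul] at h3
      norm_num at h3
      omega
    · rw [max_eq_left h1]
      refine ⟨1 + ((2 : ℕ) : ℤ) ^ 2, by norm_num, fun k i hk => ?_⟩
      refine pow_min_dvd_of_dvd_pow_sub_pow Nat.prime_two (by norm_num) (Or.inr le_rfl) hii h
        (i := i) ?_
      rwa [show 2 + (n.factorization 2 - 1) = 1 + n.factorization 2 by omega]
  · obtain ⟨rfl, ha2⟩ : p = 2 ∧ r.factorization p = 1 := by omega
    rw [ha2]
    refine ⟨1 + ((2 : ℕ) : ℤ) ^ 2, by norm_num, fun k i hk => ?_⟩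
    have hv : (q - 1).factorization 2 = 1 := by omega
    rcases Nat.lt_or_ge (n.factorization 2) 2 with hb2 | hb2
    · rw [show n.factorization 2 - 1 = 0 by omega]
      simp
    have h' : ¬ ((2 : ℕ) : ℤ) ^ 2 ∣ (q : ℤ) - 1 := by
      rw [pow_dvd_sub_one_iff Nat.prime_two hq]
      omega
    rw [hv] at h
    have hw : 2 ≤ (q + 1).factorization 2 := by
      rw [← Nat.prime_two.pow_dvd_iff_le_factorization (by omega)]
      norm_num at h h' ⊢
      omega
    have hq2 := (two_pow_dvd_sq_sub_one_iff (k := 1 + (q + 1).factorization 2) hq).mpr (by omega)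
    have hi : Even i := by
      by_contra hodd
      obtain ⟨c, rfl⟩ := Nat.not_even_iff_odd.mp hodd
      have h4 : (4 : ℤ) ∣ 5 ^ k - (q : ℤ) ^ (2 * c + 1) := by
        have := (pow_dvd_pow ((2 : ℕ) : ℤ) (by omega : 2 ≤ 1 + n.factorization 2)).trans hk
        norm_num at this
        exact this
      have h5 : (4 : ℤ) ∣ 5 ^ k - 1 :=
        (by norm_num : (4 : ℤ) ∣ 5 - 1).trans (sub_one_dvd_pow_sub_one _ _)
      have h6 : (4 : ℤ) ∣ ((q : ℤ) ^ 2) ^ c - 1 := by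
        have := (pow_dvd_pow (2 : ℤ) (by omega : 2 ≤ 1 + (q + 1).factorization 2)).trans hq2
        norm_num at this
        exact this.trans (sub_one_dvd_pow_sub_one _ _)
      rw [pow_succ, pow_mul] at h4
      have h7 : (4 : ℤ) ∣ q - 1 := by
        have h8 := dvd_sub (dvd_sub h5 h4) (h6.mul_right (q : ℤ))
        ring_nf at h8
        rw [← dvd_neg] at h8
        ring_nf at h8 ⊢
        omega
      exact h' (by norm_num; exact h7)
    obtain ⟨c, rfl⟩ := even_iff_two_dvd.mp hi
    rw [pow_mul] at hk
    have := pow_min_dvd_of_dvd_pow_sub_pow (a := 2) (b := n.factorization 2 - 1) (k := k)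
      (q := (q : ℤ) ^ 2) (v := 1 + (q + 1).factorization 2) (i := c)
      Nat.prime_two (by norm_num) (Or.inr le_rfl) (by omega) hq2
      (by rwa [show 2 + (n.factorization 2 - 1) = 1 + n.factorization 2 by omega])
    rwa [show 1 + (q + 1).factorization 2 - 2 = (q + 1).factorization 2 - 1 by omega] at this

section Splitting

variable {q n r m : ℕ} {s : ℤ}

lemma mul_mem_oneAddRZ {x y : ZMod (r * n)} (hx : x ∈ oneAddRZ n r) (hy : y ∈ oneAddRZ n r) :
    x * y ∈ oneAddRZ n r := by
  obtain ⟨k, rfl⟩ := hx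
  obtain ⟨l, rfl⟩ := hy
  exact ⟨k + l + r * k * l, by ring⟩

lemma one_mem_oneAddRZ : (1 : ZMod (r * n)) ∈ oneAddRZ n r := ⟨0, by simp⟩

lemma intCast_mem_oneAddRZ {a : ℤ} (ha : (r : ℤ) ∣ a - 1) :
    (a : ZMod (r * n)) ∈ oneAddRZ n r := by
  obtain ⟨k, hk⟩ := ha
  refine ⟨k, ?_⟩
  rw [show a = 1 + r * k by linarith]
  push_cast
  rfl

lemma IsTypeISplitting.dvd {X : ZMod m → Set (ZMod (r * n))} (hX : IsTypeISplitting q n r s m X)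
    {x : ZMod (r * n)} (hx : x ∈ oneAddRZ n r) {k i : ℕ}
    (h : (s : ZMod (r * n)) ^ k * x = (q : ZMod (r * n)) ^ i * x) : m ∣ k := by
  obtain ⟨hdisj, hunion, hXq, hXs⟩ := hX
  rw [← hunion, Set.mem_iUnion] at hx
  obtain ⟨j, hj⟩ := hx
  have h1 : ∀ k : ℕ, (s : ZMod (r * n)) ^ k * x ∈ X (j + k) := by
    intro k
    induction k with
    | zero => simpa using hj
    | succ k ih =>
      rw [pow_succ', mul_assoc, Nat.cast_succ, ← add_assoc, ← hXs]
      exact ⟨_, ih, rfl⟩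
  have h2 : ∀ i : ℕ, (q : ZMod (r * n)) ^ i * x ∈ X j := by
    intro i
    induction i with
    | zero => simpa using hj
    | succ i ih =>
      rw [pow_succ', mul_assoc, ← hXq]
      exact ⟨_, ih, rfl⟩
  have h3 := h1 k
  rw [h] at h3
  have h4 : j + k = j := by
    by_contra hne
    exact Set.disjoint_left.mp (hdisj hne) h3 (h2 i)
  rw [← ZMod.natCast_eq_zero_iff]
  simpa using h4

/-- A set stable under two finite-order units splits cyclically, provided powers of the first
only agree with powers of the second on a point when the exponent is divisible by `m`. -/
lemma exists_cyclic_splitting {R : Type*} [CommRing R] {S : Set R} {a b : R} {T : ℕ} (hT : 1 ≤ T)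
    (haT : a ^ T = 1) (hbT : b ^ T = 1) (hmT : m ∣ T)
    (haS : ∀ x ∈ S, a * x ∈ S) (hbS : ∀ x ∈ S, b * x ∈ S)
    (h : ∀ x ∈ S, ∀ k i : ℕ, a ^ k * x = b ^ i * x → m ∣ k) :
    ∃ X : ZMod m → Set R, Pairwise (Function.onFun Disjoint X) ∧ (⋃ j, X j) = S ∧
      (∀ j, (fun x => b * x) '' X j = X j) ∧ (∀ j, (fun x => a * x) '' X j = X (j + 1)) := by
  obtain ⟨T, rfl⟩ := Nat.exists_eq_add_of_le' hT
  have hinv : ∀ (c : R) (k : ℕ), c ^ (T + 1) = 1 → c ^ (k * T) * c ^ k = 1 := by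
    intro c k hc
    rw [← pow_add, show k * T + k = (T + 1) * k by ring, pow_mul, hc, one_pow]
  let orb : Setoid R :=
    { r := fun x y => ∃ k i : ℕ, y = a ^ k * b ^ i * x
      iseqv :=
        { refl := fun x => ⟨0, 0, by simp⟩
          symm := by
            rintro x y ⟨k, i, rfl⟩
            refine ⟨k * T, i * T, ?_⟩
            linear_combination (-(b ^ (i * T) * b ^ i * x)) * hinv a k haT - x * hinv b i hbT
          trans := by
            rintro x y z ⟨k, i, rfl⟩ ⟨k', i', rfl⟩
            exact ⟨k + k', i + i', by ring⟩ } }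
  let rep : R → R := fun x => (Quotient.mk orb x).out
  have hrep : ∀ x, ∃ k i : ℕ, x = a ^ k * b ^ i * rep x := fun x =>
    Quotient.exact (Quotient.out_eq (Quotient.mk orb x))
  have hrep_eq : ∀ x (k i : ℕ), rep (a ^ k * b ^ i * x) = rep x := by
    intro x k i
    have : Quotient.mk orb (a ^ k * b ^ i * x) = Quotient.mk orb x :=
      (Quotient.sound (⟨k, i, rfl⟩ : orb.r x _)).symm
    simp only [rep, this]
  have hS : ∀ x ∈ S, ∀ k i : ℕ, a ^ k * b ^ i * x ∈ S := by
    intro x hx k i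
    induction k with
    | zero =>
      induction i with
      | zero => simpa using hx
      | succ i ih => convert hbS _ ih using 1; ring
    | succ k ih => convert haS _ ih using 1; ring
  let X : ZMod m → Set R := fun j =>
    {x | x ∈ S ∧ ∃ k i : ℕ, (k : ZMod m) = j ∧ x = a ^ k * b ^ i * rep x}
  have hact : ∀ {j x}, x ∈ X j → ∀ k i : ℕ, a ^ k * b ^ i * x ∈ X (j + k) := by
    rintro j x ⟨hx, k', i', rfl, he⟩ k i
    refine ⟨hS x hx k i, k' + k, i' + i, by push_cast; ring, ?_⟩
    rw [hrep_eq]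
    conv_lhs => rw [he]
    ring
  have hTm : ((T : ℕ) : ZMod m) + 1 = 0 := by
    rw [← ZMod.natCast_eq_zero_iff] at hmT
    exact_mod_cast hmT
  refine ⟨X, ?_, ?_, ?_, ?_⟩
  · intro j j' hjj'
    refine Set.disjoint_left.mpr ?_
    rintro x ⟨hx, k, i, rfl, he⟩ ⟨-, k', i', rfl, he'⟩
    apply hjj'
    have hxr : rep x ∈ S := by
      have := hS x hx (k * T) (i * T)
      rwa [show a ^ (k * T) * b ^ (i * T) * x = rep x by
        linear_combination a ^ (k * T) * b ^ (i * T) * he +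
          b ^ (i * T) * b ^ i * rep x * hinv a k haT + rep x * hinv b i hbT] at this
    have key := h (rep x) hxr (k + k' * T) (i' + i * T) (by
      rw [pow_add, pow_add]
      linear_combination a ^ (k' * T) * b ^ (i * T) * (he' - he)
        + (-(a ^ k * a ^ (k' * T) * rep x)) * hinv b i hbT
        + (b ^ i' * b ^ (i * T) * rep x) * hinv a k' haT)
    rw [← ZMod.natCast_eq_zero_iff] at key
    push_cast at key
    linear_combination key - (k' : ZMod m) * hTm
  · ext x
    rw [Set.mem_iUnion]
    constructor
    · rintro ⟨j, hx, -⟩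
      exact hx
    · intro hx
      obtain ⟨k, i, he⟩ := hrep x
      exact ⟨k, hx, k, i, rfl, he⟩
  · intro j
    ext y
    constructor
    · rintro ⟨x, hx, rfl⟩
      simpa using hact hx 0 1
    · intro hy
      refine ⟨b ^ T * y, by simpa using hact hy 0 T, ?_⟩
      change b * (b ^ T * y) = y
      linear_combination y * hbT
  · intro j
    ext y
    constructor
    · rintro ⟨x, hx, rfl⟩
      simpa using hact hx 1 0
    · intro hy
      refine ⟨a ^ T * y, ?_, ?_⟩
      · have := hact hy T 0
        rwa [pow_zero, mul_one, show j + 1 + (T : ZMod m) = j by linear_combination hTm] at this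
      · change a * (a ^ T * y) = y
        linear_combination y * haT

lemma exists_isTypeISplitting_iff (hn : 0 < n) (hr : 0 < r) (hq : Nat.Coprime q (r * n))
    (hrq : (r : ℤ) ∣ q - 1) (hs : IsCoprime ((r * n : ℕ) : ℤ) s) (hrs : (r : ℤ) ∣ s - 1) :
    (∃ X, IsTypeISplitting q n r s m X) ↔
      ∀ x ∈ oneAddRZ n r, ∀ k i : ℕ,
        (s : ZMod (r * n)) ^ k * x = (q : ZMod (r * n)) ^ i * x → m ∣ k := by
  constructor
  · rintro ⟨X, hX⟩ x hx k i h
    exact hX.dvd hx h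
  · intro h
    have hsT : (s : ZMod (r * n)) ^ (r * n).totient = 1 := by
      obtain ⟨u, hu⟩ := (ZMod.coe_int_isUnit_iff_isCoprime s (r * n)).mpr hs
      rw [← hu, ← Units.val_pow_eq_pow_val, ZMod.pow_totient, Units.val_one]
    have hqT : (q : ZMod (r * n)) ^ (r * n).totient = 1 := by
      obtain ⟨u, hu⟩ := (ZMod.isUnit_iff_coprime q (r * n)).mpr hq
      rw [← hu, ← Units.val_pow_eq_pow_val, ZMod.pow_totient, Units.val_one]
    have hqmem : (q : ZMod (r * n)) ∈ oneAddRZ n r := by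
      simpa using intCast_mem_oneAddRZ (n := n) hrq
    exact exists_cyclic_splitting (Nat.totient_pos.mpr (by positivity)) hsT hqT
      (h 1 one_mem_oneAddRZ _ 0 (by simp [hsT]))
      (fun x hx => mul_mem_oneAddRZ (intCast_mem_oneAddRZ hrs) hx)
      (fun x hx => mul_mem_oneAddRZ hqmem hx) h

lemma exists_mem_oneAddRZ_mul_eq_zero_iff (hn : 0 < n) (hr : 0 < r) (z : ℤ) :
    (∃ x ∈ oneAddRZ n r, (z : ZMod (r * n)) * x = 0) ↔
      ∀ p : ℕ, p.Prime → p ∣ r → (p : ℤ) ^ (r * n).factorization p ∣ z := by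
  have hN : r * n ≠ 0 := by positivity
  constructor
  · rintro ⟨x, ⟨k, rfl⟩, hz⟩ p hp hpr
    obtain ⟨k, rfl⟩ := ZMod.intCast_surjective k
    have hz' : ((z * (1 + r * k) : ℤ) : ZMod (r * n)) = 0 := by
      push_cast
      exact hz
    rw [ZMod.intCast_zmod_eq_zero_iff_dvd] at hz'
    have hpN : (p : ℤ) ^ (r * n).factorization p ∣ z * (1 + r * k) :=
      Dvd.dvd.trans (by exact_mod_cast Nat.ordProj_dvd (r * n) p) hz'
    refine IsCoprime.dvd_of_dvd_mul_right (IsCoprime.pow_left ?_) hpN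
    obtain ⟨c, rfl⟩ := hpr
    exact ⟨-(c * k), 1, by push_cast; ring⟩
  · intro h
    set g := Int.gcd z (r * n : ℕ) with hg
    obtain ⟨d, hd⟩ : g ∣ r * n := by exact_mod_cast Int.gcd_dvd_right z (r * n : ℕ)
    have hd0 : d ≠ 0 := by rintro rfl; simp at hd; omega
    have hcop : Nat.Coprime d r := by
      refine Nat.coprime_of_dvd fun p hp hpd hpr => ?_
      have hpg : p ^ (r * n).factorization p ∣ g := by
        have := Int.dvd_coe_gcd (h p hp hpr) (by
          exact_mod_cast Nat.ordProj_dvd (r * n) p : _ ∣ ((r * n : ℕ) : ℤ))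
        exact_mod_cast this
      have hlt : p ^ ((r * n).factorization p + 1) ∣ r * n := by
        rw [pow_succ]
        exact (mul_dvd_mul hpg hpd).trans hd.symm.dvd
      exact Nat.pow_succ_factorization_not_dvd hN hp hlt
    obtain ⟨u, w, huw⟩ := Nat.isCoprime_iff_coprime.mpr hcop
    refine ⟨((u * d : ℤ) : ZMod (r * n)), intCast_mem_oneAddRZ ⟨-w, by linarith⟩, ?_⟩
    rw [← Int.cast_mul, ZMod.intCast_zmod_eq_zero_iff_dvd, hd, Nat.cast_mul]
    have := mul_dvd_mul (Int.gcd_dvd_left z (r * n : ℕ)) (Dvd.intro_left u rfl : (d : ℤ) ∣ u * d)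
    exact this

lemma exists_isTypeISplitting_iff_forall_prime (hn : 0 < n) (hr : 0 < r)
    (hq : Nat.Coprime q (r * n)) (hrq : (r : ℤ) ∣ q - 1) (hs : IsCoprime ((r * n : ℕ) : ℤ) s)
    (hrs : (r : ℤ) ∣ s - 1) :
    (∃ X, IsTypeISplitting q n r s m X) ↔
      ∀ k i : ℕ, (∀ p : ℕ, p.Prime → p ∣ r →
        (p : ℤ) ^ (r * n).factorization p ∣ s ^ k - (q : ℤ) ^ i) → m ∣ k := by
  rw [exists_isTypeISplitting_iff hn hr hq hrq hs hrs]
  have key : ∀ (x : ZMod (r * n)) (k i : ℕ),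
      (s : ZMod (r * n)) ^ k * x = (q : ZMod (r * n)) ^ i * x ↔
        ((s ^ k - (q : ℤ) ^ i : ℤ) : ZMod (r * n)) * x = 0 := by
    intro x k i
    push_cast
    rw [sub_mul, sub_eq_zero]
  simp only [key, ← exists_mem_oneAddRZ_mul_eq_zero_iff hn hr]
  exact ⟨fun h k i ⟨x, hx, hx'⟩ => h x hx k i hx', fun h x hx k i hx' => h k i ⟨x, hx, hx'⟩⟩

end Splitting

/-- If `x ≡ 1` modulo the `p`-part of `r`, then `x ^ t ≡ 1` modulo the `p`-part of `r * n`
whenever `t` is divisible by the `p`-part of `n`. -/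
lemma pow_factorization_mul_dvd_pow_sub_one {p r n t : ℕ} (hn : 0 < n) (hr : 0 < r) (hp : p.Prime)
    (hpr : p ∣ r) {x : ℤ} (hx : (r : ℤ) ∣ x - 1) (ht : p ^ n.factorization p ∣ t) :
    (p : ℤ) ^ (r * n).factorization p ∣ x ^ t - 1 := by
  rw [Nat.factorization_mul hr.ne' hn.ne', Finsupp.add_apply]
  refine pow_add_dvd_pow_sub_one ((hp.dvd_iff_one_le_factorization hr.ne').mp hpr) ?_ ht
  refine Dvd.dvd.trans ?_ hx
  exact_mod_cast Nat.ordProj_dvd r p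

/-- Chinese remainder theorem for the primes dividing `N`. -/
lemma exists_forall_primeFactors_dvd_sub (N : ℕ) (S : ℕ → ℤ) :
    ∃ s : ℤ, ∀ p : ℕ, p ∈ N.primeFactors → (p : ℤ) ^ N.factorization p ∣ s - S p := by
  obtain ⟨s, hs⟩ := Ideal.exists_forall_sub_mem_ideal (ι := N.primeFactors)
    (I := fun p => Ideal.span {((p : ℕ) : ℤ) ^ N.factorization p}) (by
      intro p p' hne
      refine (Ideal.isCoprime_span_singleton_iff _ _).mpr (IsCoprime.pow ?_)
      exact Nat.isCoprime_iff_coprime.mpr ((Nat.coprime_primes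
        (Nat.prime_of_mem_primeFactors p.2) (Nat.prime_of_mem_primeFactors p'.2)).mpr
          fun h => hne (Subtype.ext h))) (fun p => S p)
  exact ⟨s, fun p hp => Ideal.mem_span_singleton.mp (hs ⟨p, hp⟩)⟩

lemma intCast_dvd_of_forall_pow_factorization_dvd {r : ℕ} (hr : 0 < r) {z : ℤ}
    (h : ∀ p : ℕ, p.Prime → p ∣ r → (p : ℤ) ^ r.factorization p ∣ z) : (r : ℤ) ∣ z := by
  rw [Int.natCast_dvd, Nat.dvd_iff_prime_pow_dvd_dvd]
  intro p k hp hk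
  rcases Nat.eq_zero_or_pos k with rfl | hk0
  · simp
  have hpr : p ∣ r := (dvd_pow_self p hk0.ne').trans hk
  have hd := (pow_dvd_pow (p : ℤ) ((hp.pow_dvd_iff_le_factorization hr.ne').mp hk)).trans
    (h p hp hpr)
  rw [← Int.natCast_dvd]
  exact_mod_cast hd

/-- Theorem 1 of the paper.  Type I `m`-adic
`(q,n,r)`-constacyclic codes exist (i.e. there is some multiplier `s` and a
Type I `m`-adic splitting of `1 + r·Z_{rn}` given by `μ_s`) iff for every prime
`p` we have `ν_p(m) ≤ ν_p(M)`, where `ν_p(M)` is given by the explicit case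
formula below. -/
theorem typeI_madic_exists_iff (q n r : ℕ) (hq : IsPrimePow q)
    (hn : 0 < n) (hqn : Nat.gcd q n = 1) (hr : 0 < r) (hrdvd : r ∣ q - 1)
    (m : ℕ) (hm : 0 < m) :
    (∃ (s : ℤ) (X : ZMod m → Set (ZMod (r * n))),
        Int.gcd s (r * n) = 1 ∧ (r : ℤ) ∣ s - 1 ∧ IsTypeISplitting q n r s m X) ↔
      ∀ p : ℕ, p.Prime →
        m.factorization p ≤
          (if p ∣ r ∧ p ∣ n then
            (if p ≠ 2 ∨ 2 ≤ r.factorization p then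
              -- (i) `p` odd or `ν_p(r) ≥ 2`
              min ((q - 1).factorization p - r.factorization p) (n.factorization p)
            else if 2 ≤ (q - 1).factorization 2 then
              -- (ii.1) `p = 2`, `ν₂(r) = 1`, `ν₂(q-1) ≥ 2`
              max (min ((q - 1).factorization 2 - 2) (n.factorization 2 - 1)) 1
            else
              -- (ii.2) `p = 2`, `ν₂(r) = 1`, `ν₂(q-1) = 1`
              min ((q + 1).factorization 2 - 1) (n.factorization 2 - 1))
          else 0) := by
  have hq2 : 2 ≤ q := hq.two_le
  have hrqz : (r : ℤ) ∣ (q : ℤ) - 1 := by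
    rw [← Nat.cast_one, ← Nat.cast_sub (by omega)]
    exact_mod_cast hrdvd
  have hqr : Nat.Coprime q r := by
    rw [← Nat.isCoprime_iff_coprime]
    obtain ⟨c, hc⟩ := hrqz
    exact ⟨1, -c, by linarith⟩
  have hqN : Nat.Coprime q (r * n) := hqr.mul_right hqn
  have hN : r * n ≠ 0 := by positivity
  change _ ↔ ∀ p : ℕ, p.Prime → m.factorization p ≤ splittingExponent q n r p
  constructor
  · rintro ⟨s, X, hs, hrs, hX⟩ p hp
    have hs' : IsCoprime ((r * n : ℕ) : ℤ) s := by
      rw [isCoprime_comm, Int.isCoprime_iff_gcd_eq_one]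
      exact_mod_cast hs
    have key :=
      (exists_isTypeISplitting_iff_forall_prime (m := m) hn hr hqN hrqz hs' hrs).mp ⟨X, hX⟩
    set t := n / p ^ n.factorization p with ht
    have ht0 : t ≠ 0 := (Nat.ordCompl_pos p hn.ne').ne'
    have hpt : ¬ p ∣ t := Nat.not_dvd_ordCompl hp hn.ne'
    obtain ⟨j, hj⟩ : ∃ j : ℕ, p ∣ r → (p : ℤ) ^ (r * n).factorization p ∣
        s ^ p ^ splittingExponent q n r p - (q : ℤ) ^ j := by
      by_cases hpr : p ∣ r
      · have hps : (p : ℤ) ^ r.factorization p ∣ s - 1 :=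
          Dvd.dvd.trans (by exact_mod_cast Nat.ordProj_dvd r p) hrs
        obtain ⟨j, hj⟩ := exists_pow_dvd_pow_splittingExponent_sub hq2 hn hr hrdvd hp hpr hps
        exact ⟨j, fun _ => hj⟩
      · exact ⟨0, fun h => absurd h hpr⟩
    have hm' : m ∣ p ^ splittingExponent q n r p * t := by
      refine key _ (j * t) fun p' hp' hpr' => ?_
      rw [pow_mul, pow_mul]
      by_cases hpp : p' = p
      · subst hpp
        exact (hj hpr').trans (sub_dvd_pow_sub_pow _ _ _)
      · have htp : p' ^ n.factorization p' ∣ t := by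
          rw [hp'.pow_dvd_iff_le_factorization ht0, ht, Nat.factorization_ordCompl,
            Finsupp.erase_ne hpp]
        have h1 := pow_factorization_mul_dvd_pow_sub_one hn hr hp' hpr'
          (hrs.trans (sub_one_dvd_pow_sub_one s (p ^ splittingExponent q n r p))) htp
        have h2 := pow_factorization_mul_dvd_pow_sub_one hn hr hp' hpr'
          (hrqz.trans (sub_one_dvd_pow_sub_one (q : ℤ) j)) htp
        simpa using dvd_sub h1 h2
    have hpE : p ^ splittingExponent q n r p ≠ 0 := pow_ne_zero _ hp.ne_zero
    have hle := (Nat.factorization_le_iff_dvd hm.ne' (mul_ne_zero hpE ht0)).mpr hm' p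
    rwa [Nat.factorization_mul hpE ht0, Finsupp.add_apply, hp.factorization_pow,
      Finsupp.single_eq_same, Nat.factorization_eq_zero_of_not_dvd hpt, add_zero] at hle
  · intro h
    have hloc : ∀ p : ℕ, ∃ s : ℤ, p.Prime →
        (p : ℤ) ^ r.factorization p ∣ s - 1 ∧ (p ∣ r * n → (p : ℤ) ∣ s - 1) ∧
          ∀ k i : ℕ, (p ∣ r → (p : ℤ) ^ (r * n).factorization p ∣ s ^ k - (q : ℤ) ^ i) →
            p ^ splittingExponent q n r p ∣ k := by
      intro p
      by_cases hp : p.Prime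
      · obtain ⟨s, hs⟩ := exists_pow_splittingExponent_dvd hq2 hn hr hrdvd hp
        exact ⟨s, fun _ => hs⟩
      · exact ⟨0, fun hp' => absurd hp' hp⟩
    choose S hS using hloc
    obtain ⟨s, hs⟩ := exists_forall_primeFactors_dvd_sub (r * n) S
    have hrs : (r : ℤ) ∣ s - 1 := by
      refine intCast_dvd_of_forall_pow_factorization_dvd hr fun p hp hpr => ?_
      have h1 := hs p (Nat.mem_primeFactors.mpr ⟨hp, hpr.mul_right n, hN⟩)
      have h2 : r.factorization p ≤ (r * n).factorization p :=
        (Nat.factorization_le_iff_dvd hr.ne' hN).mpr (dvd_mul_right r n) p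
      simpa using dvd_add ((pow_dvd_pow (p : ℤ) h2).trans h1) (hS p hp).1
    have hgcd : Int.gcd s (r * n) = 1 := by
      by_contra hne
      obtain ⟨p, hp, hpd⟩ := Nat.exists_prime_and_dvd hne
      have hps : (p : ℤ) ∣ s := (Int.natCast_dvd_natCast.mpr hpd).trans (Int.gcd_dvd_left _ _)
      have hpN : p ∣ r * n := by
        exact_mod_cast (Int.natCast_dvd_natCast.mpr hpd).trans (Int.gcd_dvd_right s (r * n))
      have h1 := hs p (Nat.mem_primeFactors.mpr ⟨hp, hpN, hN⟩)
      have h2 : (p : ℤ) ∣ s - S p :=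
        (dvd_pow_self _ (hp.factorization_pos_of_dvd hN hpN).ne').trans h1
      have h3 : (p : ℤ) ∣ s - 1 := by simpa using dvd_add h2 ((hS p hp).2.1 hpN)
      have h4 : (p : ℤ) ∣ 1 := by simpa using dvd_sub hps h3
      exact (Nat.prime_iff_prime_int.mp hp).not_dvd_one h4
    have hs' : IsCoprime ((r * n : ℕ) : ℤ) s := by
      rw [isCoprime_comm, Int.isCoprime_iff_gcd_eq_one]
      exact_mod_cast hgcd
    obtain ⟨X, hX⟩ := (exists_isTypeISplitting_iff_forall_prime (m := m) hn hr hqN hrqz hs'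
      hrs).mpr fun k i hki => by
        rw [Nat.dvd_iff_prime_pow_dvd_dvd]
        intro p e hp he
        have hle := ((hp.pow_dvd_iff_le_factorization hm.ne').mp he).trans (h p hp)
        refine (pow_dvd_pow p hle).trans ((hS p hp).2.2 k i fun hpr => ?_)
        have h1 := hs p (Nat.mem_primeFactors.mpr ⟨hp, hpr.mul_right n, hN⟩)
        simpa using dvd_sub (hki p hp hpr) (h1.trans (sub_dvd_pow_sub_pow s (S p) k))
    exact ⟨s, X, hgcd, hrs, hX⟩
end

section
/- Let p be a prime. There exist an integer s with gcd(s, rn) = 1 and s ≡ 1 (mod r) and a Type I p-adic splitting of 1+rZ_{rn} given by μ_s if and only if one of the following two conditions holds: (i) ν_p(n) ≥ 1 and ν_p(q−1) > ν_p(r) ≥ 1 (the case p = 2 being allowed here); (ii) p = 2, ν₂(r) = 1 and min{ν₂(q+1), ν₂(n)} ≥ 2. (Equivalently: Type I p-adic (q,n,r)-constacyclic codes exist if and only if (i) or (ii) holds.) -/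
/-- If `a ≡ c` modulo `R` and every prime factor of `w` divides `R`, then
`a ^ w ≡ c ^ w` modulo `R * w`. -/
theorem mul_dvd_pow_sub_pow {a c : ℤ} {R : ℕ} (h : (R : ℤ) ∣ a - c) {w : ℕ}
    (hw : ∀ l : ℕ, l.Prime → l ∣ w → l ∣ R) : ((R * w : ℕ) : ℤ) ∣ a ^ w - c ^ w := by
  induction w using induction_on_primes with
  | zero => simp
  | one => simpa using h
  | prime_mul l w hl ih =>
    have hstep := ih fun l' hl' hd => hw l' hl' (hd.mul_left l)
    have hlR : l ∣ R * w := (hw l hl (dvd_mul_right l w)).mul_right w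
    have hl' : (l : ℤ) ∣ a ^ w - c ^ w := (Int.natCast_dvd_natCast.2 hlR).trans hstep
    have := mul_dvd_mul hstep (dvd_geom_sum₂_self hl')
    rw [mul_comm (a ^ w - c ^ w), geom_sum₂_mul, ← pow_mul, ← pow_mul, mul_comm w l] at this
    rw [show R * (l * w) = R * w * l by ring, Nat.cast_mul]
    exact this

/-- Raising to the power `p` lifts the exact `p`-divisibility of `Q - 1` by one. -/
theorem exists_pow_prime_sub_one_eq {p : ℕ} (hp : p.Prime) {R Q c : ℤ} (hpR : (p : ℤ) ∣ R)
    (h4 : p ≠ 2 ∨ 4 ∣ R) (hQ : Q - 1 = R * c) (hc : ¬ (p : ℤ) ∣ c) :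
    ∃ c', Q ^ p - 1 = R * p * c' ∧ ¬ (p : ℤ) ∣ c' := by
  have hsum : (p : ℤ) ^ 2 ∣ ∑ i ∈ Finset.range p, Q ^ i - p := by
    rcases eq_or_ne p 2 with rfl | hp2
    · obtain ⟨d, rfl⟩ := h4.resolve_left (by simp)
      refine ⟨d * c, ?_⟩
      norm_num [Finset.sum_range_succ]
      linear_combination hQ
    · obtain ⟨d, rfl⟩ := hpR
      have := odd_sq_dvd_geom_sum₂_sub (R := ℤ) (a := 1) (b := d * c)
        (hp.odd_of_ne_two hp2)
      have hQ' : Q = 1 + p * (d * c) := by linear_combination hQ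
      simpa [hQ'] using this
  obtain ⟨k, hk⟩ := hsum
  refine ⟨c * (1 + p * k), ?_, ?_⟩
  · rw [← geom_sum_mul, hQ]
    linear_combination R * c * hk
  · intro h
    have : c = c * (1 + p * k) - p * (k * c) := by ring
    exact hc (this ▸ dvd_sub h (dvd_mul_right _ _))

/-- If `Q ^ m - 1` is divisible by `R` but not by `R * p`, a congruence to a power of `Q`
modulo `R` can be refined to one modulo `R * p`. -/
theorem exists_mul_prime_dvd_sub_pow {p : ℕ} (hp : p.Prime) {R Q S c : ℤ} {m j : ℕ}
    (hpR : (p : ℤ) ∣ R) (hpQ : (p : ℤ) ∣ Q - 1) (hQ : Q ^ m - 1 = R * c)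
    (hc : ¬ (p : ℤ) ∣ c) (hS : R ∣ S - Q ^ j) : ∃ j', R * p ∣ S - Q ^ j' := by
  have := Fact.mk hp
  obtain ⟨t, ht⟩ := hS
  have hc' : (c : ZMod p) ≠ 0 := by rwa [Ne, ZMod.intCast_zmod_eq_zero_iff_dvd]
  have hQ1 : (Q : ZMod p) = 1 := by
    have := (ZMod.intCast_zmod_eq_zero_iff_dvd (Q - 1) p).2 hpQ
    push_cast at this
    linear_combination this
  set i : ℕ := ((t : ZMod p) * (c : ZMod p)⁻¹).val with hi
  have hi' : (i : ZMod p) = t * (c : ZMod p)⁻¹ := by simp [hi]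
  have hsq : R * p ∣ Q ^ (m * i) - 1 - R * c * i := by
    have hQm : Q ^ m = 1 + R * c := by linear_combination hQ
    have hsum : (p : ℤ) ∣ ∑ k ∈ Finset.range i, (1 + R * c) ^ k - i := by
      rw [← ZMod.intCast_zmod_eq_zero_iff_dvd]
      have : (R : ZMod p) = 0 := (ZMod.intCast_zmod_eq_zero_iff_dvd _ _).2 hpR
      simp [this]
    rw [pow_mul, hQm, ← geom_sum_mul]
    obtain ⟨u, hu⟩ := hsum
    exact ⟨c * u, by linear_combination R * c * hu⟩
  have hlin : (p : ℤ) ∣ t - Q ^ j * (c * i) := by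
    rw [← ZMod.intCast_zmod_eq_zero_iff_dvd]
    push_cast
    rw [hQ1, hi']
    field_simp
    simp
  obtain ⟨u, hu⟩ := hsq
  obtain ⟨v, hv⟩ := hlin
  exact ⟨j + m * i, v - Q ^ j * u, by
    rw [pow_add]; linear_combination ht + R * hv - Q ^ j * hu⟩

/-- If `Q - 1` is divisible by `R` but not by `R * p`, where `p ∣ R` and `4 ∣ R` in case
`p = 2`, then `Q` generates the residues congruent to `1` modulo `R` in the integers modulo
`R * p ^ b`. -/
theorem exists_mul_prime_pow_dvd_sub_pow {p : ℕ} (hp : p.Prime) {R Q S c : ℤ}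
    (hpR : (p : ℤ) ∣ R) (h4 : p ≠ 2 ∨ 4 ∣ R) (hQ : Q - 1 = R * c) (hc : ¬ (p : ℤ) ∣ c)
    (hS : R ∣ S - 1) (b : ℕ) : ∃ j : ℕ, R * (p : ℤ) ^ b ∣ S - Q ^ j := by
  have hpQ : (p : ℤ) ∣ Q - 1 := hQ ▸ hpR.mul_right c
  suffices h : (∃ j : ℕ, R * (p : ℤ) ^ b ∣ S - Q ^ j) ∧
      ∃ c', Q ^ p ^ b - 1 = R * (p : ℤ) ^ b * c' ∧ ¬ (p : ℤ) ∣ c' from h.1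
  induction b with
  | zero => exact ⟨⟨0, by simpa using hS⟩, c, by simpa using hQ, hc⟩
  | succ b ih =>
    obtain ⟨⟨j, hj⟩, c', hc', hpc'⟩ := ih
    have hpR' := hpR.mul_right ((p : ℤ) ^ b)
    have h4' := h4.imp_right fun h => h.mul_right ((p : ℤ) ^ b)
    obtain ⟨d, hd, hpd⟩ := exists_pow_prime_sub_one_eq hp hpR' h4' hc' hpc'
    simp only [pow_succ, ← mul_assoc]
    exact ⟨exists_mul_prime_dvd_sub_pow hp hpR' hpQ hc' hpc' hj, d, by rw [pow_mul, hd], hpd⟩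

/-- Every positive integer is the product of a part supported on the primes dividing `r` and
a part coprime to `r`. -/
theorem exists_eq_mul_supported_coprime (r n : ℕ) (hn : n ≠ 0) :
    ∃ w m : ℕ, n = w * m ∧ (∀ l : ℕ, l.Prime → l ∣ w → l ∣ r) ∧ m.Coprime r := by
  induction n using induction_on_primes with
  | zero => exact absurd rfl hn
  | one => exact ⟨1, 1, rfl, fun l hl h => absurd (Nat.dvd_one.1 h) hl.ne_one, by simp⟩
  | prime_mul l n hl ih =>
    obtain ⟨w, m, rfl, hw, hm⟩ := ih (right_ne_zero_of_mul hn)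
    by_cases hlr : l ∣ r
    · refine ⟨l * w, m, by ring, fun l' hl' h => ?_, hm⟩
      rcases hl'.dvd_mul.1 h with h | h
      · rwa [(Nat.prime_dvd_prime_iff_eq hl' hl).1 h]
      · exact hw l' hl' h
    · exact ⟨w, l * m, by ring, hw, Nat.Coprime.mul_left ((hl.coprime_iff_not_dvd).2 hlr) hm⟩

theorem IsTypeISplitting.dvd_of_pow_mul_eq {q n r m : ℕ} {s : ℤ}
    {X : ZMod m → Set (ZMod (r * n))} (h : IsTypeISplitting q n r s m X)
    {x : ZMod (r * n)} (hx : x ∈ oneAddRZ n r) {k j : ℕ}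
    (hkj : (s : ZMod (r * n)) ^ k * x = (q : ZMod (r * n)) ^ j * x) : m ∣ k := by
  obtain ⟨hdisj, hunion, hqX, hsX⟩ := h
  obtain ⟨i, hi⟩ := Set.mem_iUnion.1 (hunion.symm ▸ hx)
  have hqj : ∀ j : ℕ, (q : ZMod (r * n)) ^ j * x ∈ X i := by
    intro j
    induction j with
    | zero => simpa using hi
    | succ j ih => exact hqX i ▸ ⟨_, ih, by ring⟩
  have hsk : ∀ k : ℕ, (s : ZMod (r * n)) ^ k * x ∈ X (i + k) := by
    intro k
    induction k with
    | zero => simpa using hi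
    | succ k ih =>
      have := hsX (i + k) ▸ Set.mem_image_of_mem (fun x => (s : ZMod (r * n)) * x) ih
      rw [Nat.cast_succ, ← add_assoc]
      convert this using 1
      ring
  by_contra hmk
  have hne : i + (k : ZMod m) ≠ i := by
    simpa [ZMod.natCast_eq_zero_iff] using hmk
  exact Set.disjoint_left.1 (hdisj hne) (hsk k) (hkj ▸ hqj j)

/-- A function on `1 + r·Z_{rn}` that is invariant under `μ_q` and increased by one by `μ_s`
has a Type I splitting as its fibres. -/
theorem isTypeISplitting_of_map {q n r m : ℕ} {s : ℤ}
    (hqu : IsUnit (q : ZMod (r * n))) (hsu : IsUnit (s : ZMod (r * n)))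
    (hq : (q : ZMod (r * n)) ∈ oneAddRZ n r) (hs : (s : ZMod (r * n)) ∈ oneAddRZ n r)
    (f : ZMod (r * n) → ZMod m)
    (hfq : ∀ x ∈ oneAddRZ n r, f (q * x) = f x)
    (hfs : ∀ x ∈ oneAddRZ n r, f (s * x) = f x + 1) :
    IsTypeISplitting q n r s m fun j => {x | x ∈ oneAddRZ n r ∧ f x = j} := by
  have hmul : ∀ {u : ZMod (r * n)}, IsUnit u → u ∈ oneAddRZ n r →
      ∀ x, u * x ∈ oneAddRZ n r ↔ x ∈ oneAddRZ n r := by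
    rintro _ ⟨u, rfl⟩ ⟨k, hk⟩ x
    constructor
    · rintro ⟨l, hl⟩
      refine ⟨l * u⁻¹ - k * u⁻¹, ?_⟩
      have := Units.inv_mul u
      linear_combination (u⁻¹ : (ZMod (r * n))ˣ).val * hl - (u⁻¹ : (ZMod (r * n))ˣ).val * hk -
        (x - 1) * this
    · rintro ⟨l, rfl⟩
      exact ⟨k + l + r * k * l, by rw [hk]; ring⟩
  refine ⟨fun i j hij => Set.disjoint_left.2 fun x hx hy => hij (hx.2.symm.trans hy.2),
    by ext; simp, fun j => ?_, fun j => ?_⟩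
  · refine Set.Subset.antisymm ?_ fun y hy => ?_
    · rintro _ ⟨x, ⟨hx, rfl⟩, rfl⟩
      exact ⟨(hmul hqu hq x).2 hx, hfq x hx⟩
    · obtain ⟨x, rfl⟩ := hqu.dvd (a := y)
      have hx := (hmul hqu hq x).1 hy.1
      exact ⟨x, ⟨hx, (hfq x hx).symm.trans hy.2⟩, rfl⟩
  · refine Set.Subset.antisymm ?_ fun y hy => ?_
    · rintro _ ⟨x, ⟨hx, rfl⟩, rfl⟩
      exact ⟨(hmul hsu hs x).2 hx, hfs x hx⟩
    · obtain ⟨x, rfl⟩ := hsu.dvd (a := y)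
      have hx := (hmul hsu hs x).1 hy.1
      exact ⟨x, ⟨hx, add_right_cancel ((hfs x hx).symm.trans hy.2)⟩, rfl⟩

/-- A residue coprime to `M` lifts to an integer coprime to a given nonzero multiple `N`. -/
theorem exists_coprime_lift {M N c : ℕ} (hMN : M ∣ N) (hN : N ≠ 0) (hc : c.Coprime M) :
    ∃ s : ℕ, s.Coprime N ∧ (M : ℤ) ∣ s - c := by
  have := NeZero.mk hN
  obtain ⟨u, hu⟩ := ZMod.unitsMap_surjective hMN (ZMod.unitOfCoprime c hc)
  refine ⟨u.val.val, ZMod.val_coe_unit_coprime u, ?_⟩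
  have h := congrArg Units.val hu
  rw [ZMod.unitsMap_val, ZMod.coe_unitOfCoprime, ZMod.cast_eq_val] at h
  rw [← ZMod.intCast_zmod_eq_zero_iff_dvd]
  push_cast
  rw [h, sub_self]

theorem not_isTypeISplitting_of_dvd {q n r p b : ℕ} (hp : p.Prime) (hn : n ≠ 0)
    (hb : p ^ b ∣ n) (hbr : p ∣ r → ¬ p ∣ n / p ^ b) (hb0 : p ∣ r ∨ b = 0)
    {s : ℤ} {j : ℕ} (hsj : ((r * p ^ b : ℕ) : ℤ) ∣ s - (q : ℤ) ^ j)
    (X : ZMod p → Set (ZMod (r * n))) : ¬ IsTypeISplitting q n r s p X := by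
  intro hX
  obtain ⟨n', rfl⟩ := hb
  rw [Nat.mul_div_cancel_left _ (pow_pos hp.pos b)] at hbr
  obtain ⟨w, m, rfl, hw, hm⟩ := exists_eq_mul_supported_coprime r n' (right_ne_zero_of_mul hn)
  have hpw : ¬ p ∣ w := fun h => hbr (hw p hp h) (h.mul_right m)
  have hmw : m.Coprime w := Nat.Coprime.symm <| Nat.coprime_of_dvd fun l hl hlw hlm =>
    hl.not_dvd_one (hm ▸ Nat.dvd_gcd hlm (hw l hl hlw))
  have hmp : m.Coprime (p ^ b) := by
    rcases hb0 with h | rfl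
    · exact (hm.coprime_dvd_right h).pow_right b
    · simp
  have hcop : (r * p ^ b * w).Coprime m :=
    ((hm.mul_right hmp).mul_right hmw).symm
  obtain ⟨x, hx1, hx0⟩ := Nat.chineseRemainder hcop 1 0
  have hdvd := mul_dvd_pow_sub_pow hsj (w := w) fun l hl h => (hw l hl h).mul_right _
  refine hpw (hX.dvd_of_pow_mul_eq (x := (x : ZMod (r * (p ^ b * (w * m))))) (j := j * w) ?_ ?_)
  · obtain ⟨k, hk⟩ := (Nat.modEq_iff_dvd.1 hx1.symm)
    refine ⟨((p ^ b * w * k : ℤ) : ZMod _), ?_⟩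
    have hx : (x : ℤ) = 1 + r * (p ^ b * w * k) := by
      push_cast at hk
      linear_combination hk
    simpa using congrArg (Int.cast : ℤ → ZMod (r * (p ^ b * (w * m)))) hx
  · have hxm : (m : ℤ) ∣ x := by
      exact_mod_cast Nat.modEq_zero_iff_dvd.1 hx0
    have h := mul_dvd_mul hdvd hxm
    have h' : ((r * (p ^ b * (w * m)) : ℕ) : ℤ) ∣ (s ^ w - ((q : ℤ) ^ j) ^ w) * x := by
      rw [show r * (p ^ b * (w * m)) = r * p ^ b * w * m by ring, Nat.cast_mul]
      exact h
    have h0 := (ZMod.intCast_zmod_eq_zero_iff_dvd _ _).2 h'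
    push_cast at h0
    rw [pow_mul]
    linear_combination h0

/-- For `x = 1 + r * k` in `Z_{rn}` and `M ∣ n`, the residue of `k` modulo `M`. -/
def oneAddIndex (n r M : ℕ) (x : ZMod (r * n)) : ZMod M :=
  (((x.val : ℤ) - 1) / r : ℤ)

theorem oneAddIndex_intCast {n r M : ℕ} (hn : 0 < n) (hr : 0 < r) (hM : M ∣ n) (k : ℤ) :
    oneAddIndex n r M ((1 + r * k : ℤ) : ZMod (r * n)) = k := by
  have := NeZero.mk (Nat.mul_pos hr hn).ne'
  obtain ⟨M', rfl⟩ := hM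
  have hr' : (r : ℤ) ≠ 0 := by exact_mod_cast hr.ne'
  have h := Int.emod_add_mul_ediv (1 + r * k) (r * (M * M') : ℕ)
  rw [oneAddIndex, ZMod.val_intCast]
  set e := (1 + r * k : ℤ) / (r * (M * M') : ℕ)
  have h' : (1 + r * k : ℤ) % (r * (M * M') : ℕ) - 1 = r * (k - M * (M' * e)) := by
    push_cast at h ⊢
    linear_combination h
  rw [h', Int.mul_ediv_cancel_left _ hr']
  simp

theorem exists_eq_intCast_of_mem_oneAddRZ {n r : ℕ} {x : ZMod (r * n)}
    (hx : x ∈ oneAddRZ n r) : ∃ k : ℤ, x = (1 + r * k : ℤ) := by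
  obtain ⟨k, rfl⟩ := hx
  obtain ⟨k, rfl⟩ := ZMod.intCast_surjective k
  exact ⟨k, by push_cast; rfl⟩

/-- In the coordinate `k` of `1 + r * k`, the multiplier `1 + r * a` acts by
`k ↦ k + a + r * a * k`. A map `g` invariant under the action of `q = 1 + r * a` and increased
by one under that of `1 + r * c` yields a splitting. -/
theorem exists_isTypeISplitting_of_index {q n r m a c M : ℕ} (hn : 0 < n) (hr : 0 < r)
    (hqn : Nat.gcd q n = 1) (hqa : q = 1 + r * a) (hM : M ∣ n)
    (hc : (1 + r * c).Coprime (r * M)) (g : ZMod M → ZMod m)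
    (hga : ∀ k, g (k + a + r * a * k) = g k) (hgc : ∀ k, g (k + c + r * c * k) = g k + 1) :
    ∃ (s : ℤ) (X : ZMod m → Set (ZMod (r * n))),
      Int.gcd s (r * n) = 1 ∧ (r : ℤ) ∣ s - 1 ∧ IsTypeISplitting q n r s m X := by
  obtain ⟨s, hs, e, he⟩ := exists_coprime_lift (mul_dvd_mul_left r hM) (Nat.mul_pos hr hn).ne' hc
  push_cast at he
  have hse : (s : ℤ) = 1 + r * (c + M * e : ℤ) := by linear_combination he
  have hqr : Nat.Coprime q r := by simp [hqa]
  have hindex : ∀ t b : ℤ, t = 1 + r * b → ∀ x ∈ oneAddRZ n r,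
      oneAddIndex n r M (t * x) =
        oneAddIndex n r M x + b + r * b * oneAddIndex n r M x := by
    rintro t b rfl x hx
    obtain ⟨k, rfl⟩ := exists_eq_intCast_of_mem_oneAddRZ hx
    rw [← Int.cast_mul, show (1 + r * b) * (1 + r * k) = 1 + r * (k + b + r * b * k) by ring,
      oneAddIndex_intCast hn hr hM, oneAddIndex_intCast hn hr hM]
    push_cast
    rfl
  refine ⟨s, _, by exact_mod_cast hs, ⟨c + M * e, by linear_combination hse⟩,
    isTypeISplitting_of_map ?_ ?_ ⟨a, by rw [hqa]; push_cast; rfl⟩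
      ⟨(c + M * e : ℤ), by rw [hse]; push_cast; rfl⟩
      (fun x => g (oneAddIndex n r M x)) (fun x hx => ?_) fun x hx => ?_⟩
  · exact (ZMod.isUnit_iff_coprime _ _).2 (hqr.mul_right hqn)
  · rw [Int.cast_natCast]
    exact (ZMod.isUnit_iff_coprime _ _).2 hs
  · have := hindex q a (by rw [hqa]; push_cast; rfl) x hx
    simp only [Int.cast_natCast] at this
    rw [this, hga]
  · rw [hindex s _ hse x hx]
    simpa using hgc (oneAddIndex n r M x)

/-- Corollary on `p`-adic codes.  For a prime `p`, Type I
`p`-adic `(q,n,r)`-constacyclic codes exist (i.e. there are an integer `s` with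
`gcd(s, rn) = 1`, `s ≡ 1 (mod r)`, and a Type I `p`-adic splitting of
`1 + r·Z_{rn}` given by `μ_s`) iff either
(i) `ν_p(n) ≥ 1` and `ν_p(q-1) > ν_p(r) ≥ 1`, or
(ii) `p = 2`, `ν₂(r) = 1` and `min (ν₂(q+1)) (ν₂(n)) ≥ 2`. -/
theorem typeI_padic_exists_iff (q n r : ℕ) (hq : IsPrimePow q)
    (hn : 0 < n) (hqn : Nat.gcd q n = 1) (hr : 0 < r) (hrdvd : r ∣ q - 1)
    (p : ℕ) (hp : p.Prime) :
    (∃ (s : ℤ) (X : ZMod p → Set (ZMod (r * n))),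
        Int.gcd s (r * n) = 1 ∧ (r : ℤ) ∣ s - 1 ∧ IsTypeISplitting q n r s p X) ↔
      ((1 ≤ n.factorization p ∧ r.factorization p < (q - 1).factorization p ∧
          1 ≤ r.factorization p) ∨
        (p = 2 ∧ r.factorization 2 = 1 ∧
          2 ≤ min ((q + 1).factorization 2) (n.factorization 2))) := by
  have hq1 : q - 1 ≠ 0 := Nat.sub_ne_zero_of_lt hq.one_lt
  obtain ⟨c, hc⟩ := hrdvd
  have hqc : q = 1 + r * c := by have := hq.one_lt; omega
  have hc0 : c ≠ 0 := by rintro rfl; exact hq1 (by simpa using hc)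
  have hfac : (q - 1).factorization p = r.factorization p + c.factorization p := by
    rw [hc, Nat.factorization_mul hr.ne' hc0]; rfl
  have hone : ∀ {a : ℕ}, a ≠ 0 → (1 ≤ a.factorization p ↔ p ∣ a) := fun ha =>
    (hp.dvd_iff_one_le_factorization ha).symm
  have htwo : ∀ {a : ℕ}, a ≠ 0 → (2 ≤ a.factorization 2 ↔ 4 ∣ a) := fun ha =>
    (Nat.prime_two.pow_dvd_iff_le_factorization (k := 2) ha).symm
  rw [hfac, hone hn.ne', lt_add_iff_pos_right, ← Nat.one_le_iff_ne_zero.trans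
    Nat.pos_iff_ne_zero.symm, hone hc0, hone hr.ne', le_min_iff, htwo hn.ne', htwo q.succ_ne_zero]
  constructor
  · rintro ⟨s, X, -, hs, hX⟩
    by_contra! hcon
    obtain ⟨hcon1, hcon2⟩ := hcon
    by_cases hpr : p ∣ r
    · have hpr' : (p : ℤ) ∣ r := Int.natCast_dvd_natCast.2 hpr
      have hdiv := Nat.ordProj_dvd n p
      suffices ∃ j : ℕ, (r : ℤ) * (p : ℤ) ^ n.factorization p ∣ s - (q : ℤ) ^ j by
        obtain ⟨j, hj⟩ := this
        exact not_isTypeISplitting_of_dvd hp hn.ne' hdiv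
          (fun _ => Nat.not_dvd_ordCompl hp hn.ne') (.inl hpr) (by exact_mod_cast hj) X hX
      by_cases hpn : p ∣ n
      · have hpc : ¬ p ∣ c := fun h => hcon1 hpn h hpr
        have hpc' : ¬ (p : ℤ) ∣ c := by rwa [Int.natCast_dvd_natCast]
        have hQ : (q : ℤ) - 1 = r * c := by rw [hqc]; push_cast; ring
        by_cases h4 : p ≠ 2 ∨ 4 ∣ r
        · exact exists_mul_prime_pow_dvd_sub_pow hp hpr'
            (h4.imp_right fun h => by exact_mod_cast h) hQ hpc' hs _
        · push Not at h4
          obtain ⟨rfl, h4⟩ := h4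
          have hr1 : r.factorization 2 = 1 := by
            have h1 := (hone hr.ne').2 hpr
            have h2 := mt (htwo hr.ne').1 h4
            omega
          have hq4 : 4 ∣ q + 1 := by
            obtain ⟨d, rfl⟩ := hpr
            have hd : d % 2 = 1 := by omega
            have hc2 : c % 2 = 1 := by omega
            have := Nat.mul_mod d c 2
            rw [hd, hc2] at this
            rw [mul_assoc] at hqc
            omega
          have hn1 : n.factorization 2 = 1 := by
            have h1 := (hone hn.ne').2 hpn
            have h2 := mt (htwo hn.ne').1 (hcon2 rfl hr1 hq4)
            omega
          rw [hn1, pow_one]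
          exact exists_mul_prime_dvd_sub_pow (m := 1) (j := 0) hp hpr' (hQ ▸ hpr'.mul_right _)
            (by simpa using hQ) hpc' (by simpa using hs)
      · exact ⟨0, by simpa [Nat.factorization_eq_zero_of_not_dvd hpn] using hs⟩
    · exact not_isTypeISplitting_of_dvd (b := 0) (j := 0) hp hn.ne' (by simp)
        (fun h => absurd h hpr) (.inr rfl) (by simpa using hs) X hX
  · rintro (⟨hpn, hpc, hpr⟩ | ⟨rfl, hr2, hq4, hn4⟩)
    · have hcop : (1 + r * 1).Coprime r := by simp
      have hc0 : (c : ZMod p) = 0 := (ZMod.natCast_eq_zero_iff _ _).2 hpc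
      have hr0 : (r : ZMod p) = 0 := (ZMod.natCast_eq_zero_iff _ _).2 hpr
      exact exists_isTypeISplitting_of_index (c := 1) hn hr hqn hqc hpn
        (hcop.mul_right (hcop.coprime_dvd_right hpr)) id (by simp [hc0]) (by simp [hr0])
    · obtain ⟨d, rfl⟩ : 2 ∣ r := (hone hr.ne').1 hr2.ge
      have hdc : d * c % 2 = 1 := by
        rw [mul_assoc] at hqc
        omega
      have hodd : ∀ a b : ZMod 4, 2 * (a * b) = 2 → ∀ k : ZMod 4,
          ((if k + b + 2 * a * b * k = 0 ∨ k + b + 2 * a * b * k = b then 0 else 1 : ZMod 2) =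
            if k = 0 ∨ k = b then 0 else 1) ∧
          ((if k + 2 + 2 * a * 2 * k = 0 ∨ k + 2 + 2 * a * 2 * k = b then 0 else 1 : ZMod 2) =
            (if k = 0 ∨ k = b then 0 else 1) + 1) := by
        decide
      have h2 : 2 * ((d : ZMod 4) * c) = 2 := by
        have : (2 * (d * c)) ≡ 2 [MOD 4] := by
          unfold Nat.ModEq
          omega
        exact_mod_cast (ZMod.natCast_eq_natCast_iff _ _ _).2 this
      have hcop : (1 + 2 * d * 2).Coprime (2 * d) := by simp
      have hcop4 : (1 + 2 * d * 2).Coprime (2 ^ 2) :=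
        (hcop.coprime_dvd_right (dvd_mul_right 2 d)).pow_right 2
      exact exists_isTypeISplitting_of_index (c := 2) hn hr hqn hqc hn4 (hcop.mul_right hcop4)
        (fun k => if k = 0 ∨ k = (c : ZMod 4) then 0 else 1)
        (fun k => by simpa using (hodd d c h2 k).1) (fun k => by simpa using (hodd d c h2 k).2)
end
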